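/- arXiv:2009.08888 — 2 statements merged into one kernel-verified Lean document; each statement's English description precedes it below -/
import Mathlib

section
/- For a cyclic Nakayama algebra Λ, findim Λ = 1 if and only if findim Λ^op = 1. -/
open Function DirectSum
open scoped Classical

noncomputable section

section Preamble

variable (A : Type) [Ring A]

/-- A submodule is small (superfluous) if it has no proper supplement. -/
def IsSmallSubmodule {M : Type} [AddCommGroup M] [Module A M] (N : Submodule A M) : Prop :=
  ∀ K : Submodule A M, N ⊔ K = ⊤ → K = ⊤

/-- `P` is a projective cover of `M`: `P` is projective, finitely generated, and there is a
surjection `P → M` with small (superfluous) kernel. -/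
def IsProjCoverOf (P M : ModuleCat.{0} A) : Prop :=
  Module.Projective A ↥P ∧ Module.Finite A ↥P ∧
    ∃ f : ↥P →ₗ[A] ↥M, Function.Surjective f ∧ IsSmallSubmodule A (LinearMap.ker f)

/-- `N` is (isomorphic to) the syzygy `Ω(M)`, i.e. the kernel of a projective cover of `M`. -/
def IsSyzygyOf (N M : ModuleCat.{0} A) : Prop :=
  ∃ (P : ModuleCat.{0} A) (f : ↥P →ₗ[A] ↥M),
    Module.Projective A ↥P ∧ Module.Finite A ↥P ∧ Function.Surjective f ∧
      IsSmallSubmodule A (LinearMap.ker f) ∧ Nonempty (↥N ≃ₗ[A] ↥(LinearMap.ker f))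

/-- `N` is (isomorphic to) the `n`-th syzygy `Ω^n(M)`. -/
def IsNthSyzygyOf : ℕ → ModuleCat.{0} A → ModuleCat.{0} A → Prop
  | 0 => fun N M => Nonempty (↥N ≃ₗ[A] ↥M)
  | n + 1 => fun N M => ∃ K : ModuleCat.{0} A, IsNthSyzygyOf n K M ∧ IsSyzygyOf A N K

/-- An indecomposable module: nontrivial, with no nontrivial direct sum decomposition. -/
def IndecomposableModule (M : ModuleCat.{0} A) : Prop :=
  Nontrivial ↥M ∧ ∀ N N' : Submodule A ↥M, IsCompl N N' → N = ⊥ ∨ N = ⊤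

/-- A uniserial module: the submodules form a chain. -/
def IsUniserialModule (M : ModuleCat.{0} A) : Prop :=
  ∀ N N' : Submodule A ↥M, N ≤ N' ∨ N' ≤ N

/-- A (one-sided) Nakayama condition: an Artinian ring all of whose finitely generated
indecomposable modules are uniserial. -/
def IsNakayamaRing : Prop :=
  IsArtinianRing A ∧
    ∀ M : ModuleCat.{0} A, Module.Finite A ↥M → IndecomposableModule A M → IsUniserialModule A M

/-- A Nakayama algebra: all indecomposable finitely generated (left and right) modules
are uniserial. -/
def IsNakayamaAlgebra : Prop := IsNakayamaRing A ∧ IsNakayamaRing Aᵐᵒᵖ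

/-- Connectedness: the only central idempotents are `0` and `1`. -/
def IsConnectedRing : Prop :=
  ∀ e : A, IsIdempotentElem e → e ∈ Set.center A → e = 0 ∨ e = 1

/-- A cyclic Nakayama algebra: a connected Nakayama algebra whose quiver is a cyclically
oriented cycle, equivalently with no simple projective module. -/
def IsCyclicNakayama : Prop :=
  IsNakayamaAlgebra A ∧ IsConnectedRing A ∧
    ∀ M : ModuleCat.{0} A, IsSimpleModule A ↥M → ¬ Module.Projective A ↥M

/-- The projective dimension of a module, computed via minimal projective resolutions:
the least `n` such that `Ω^n(M)` is projective (`⊤ = ∞` if there is none). -/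
def projDim (M : ModuleCat.{0} A) : ℕ∞ :=
  sInf ((fun n : ℕ => (n : ℕ∞)) ''
    {n : ℕ | ∃ N : ModuleCat.{0} A, IsNthSyzygyOf A n N M ∧ Module.Projective A ↥N})

/-- The finitistic dimension: the supremum of the (finite) projective dimensions of
finitely generated modules of finite projective dimension. -/
def finDim : ℕ∞ :=
  sSup {d : ℕ∞ | d ≠ ⊤ ∧ ∃ M : ModuleCat.{0} A, Module.Finite A ↥M ∧ projDim A M = d}

/-- The global dimension: the supremum of the projective dimensions of all finitely
generated modules. -/
def globalDim : ℕ∞ :=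
  sSup {d : ℕ∞ | ∃ M : ModuleCat.{0} A, Module.Finite A ↥M ∧ projDim A M = d}

/-- `N` is a direct summand of `M`. -/
def IsDirectSummandOf (N M : ModuleCat.{0} A) : Prop :=
  ∃ C : ModuleCat.{0} A, Nonempty (↥M ≃ₗ[A] (↥N × ↥C))

/-- The delooping level of a module `M`:
`del M = min { d | Ω^d(M) is a direct summand of A ⊕ Ω^{d+1}(M') for some f.g. M' }`. -/
def delMod (M : ModuleCat.{0} A) : ℕ∞ :=
  sInf ((fun n : ℕ => (n : ℕ∞)) ''
    {d : ℕ | ∃ (M' N N' : ModuleCat.{0} A), Module.Finite A ↥M' ∧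
      IsNthSyzygyOf A d N M ∧ IsNthSyzygyOf A (d + 1) N' M' ∧
      IsDirectSummandOf A N (ModuleCat.of A (A × ↥N'))})

/-- The delooping level of the algebra: the supremum over simple modules. -/
def delAlg : ℕ∞ :=
  sSup {d : ℕ∞ | ∃ S : ModuleCat.{0} A, IsSimpleModule A ↥S ∧ delMod A S = d}

/-- A periodic module: `Ω^t(M) ≅ M` for some `t ≥ 1`. -/
def IsPeriodicModule (M : ModuleCat.{0} A) : Prop :=
  ∃ t : ℕ, 1 ≤ t ∧ IsNthSyzygyOf A t M M

/-- Selfinjectivity: the regular module is injective. -/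
def IsSelfinjectiveRing : Prop := Module.Injective A A

/-- The socle of a module: the sum of all simple submodules. -/
def socleOf (M : ModuleCat.{0} A) : Submodule A ↥M :=
  sSup {N : Submodule A ↥M | IsSimpleModule A ↥N}

/-- The radical of a module: `rad M = J(A)·M`. -/
def radOf (M : Type) [AddCommGroup M] [Module A M] : Submodule A M :=
  (Ideal.jacobson (⊥ : Ideal A)) • (⊤ : Submodule A M)

/-- The top of a module: `M / rad M`. -/
abbrev topOf (M : Type) [AddCommGroup M] [Module A M] :=
  M ⧸ radOf A M

end Preamble

section Phi

variable (A : Type) [Ring A]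

/-- Finitely generated indecomposable modules. -/
def FGIndec := {M : ModuleCat.{0} A // Module.Finite A ↥M ∧ IndecomposableModule A M}

/-- Isomorphism as a setoid on finitely generated indecomposable modules. -/
def indecSetoid : Setoid (FGIndec A) where
  r X Y := Nonempty (↥X.1 ≃ₗ[A] ↥Y.1)
  iseqv := ⟨fun _ => ⟨LinearEquiv.refl A _⟩,
            fun h => h.elim fun e => ⟨e.symm⟩,
            fun h h' => h.elim fun e => h'.elim fun e' => ⟨e.trans e'⟩⟩

/-- Isomorphism classes of finitely generated indecomposable modules. -/
abbrev IndecIso := Quotient (indecSetoid A)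

/-- The free abelian group on iso-classes of f.g. indecomposable modules. -/
abbrev K0Group := IndecIso A →₀ ℤ

/-- `f` records a decomposition of `M` as a direct sum of indecomposables with
multiplicities. -/
def IsDecompositionOf (f : IndecIso A →₀ ℕ) (M : ModuleCat.{0} A) : Prop :=
  Nonempty (↥M ≃ₗ[A] DirectSum (Σ x : f.support, Fin (f x.1))
    (fun i => ↥((Quotient.out i.1.1).1)))

/-- The class of `M` in the free abelian group on indecomposables (junk value `0` if no
decomposition exists). -/
def decompClass (M : ModuleCat.{0} A) : K0Group A :=
  if h : ∃ f : IndecIso A →₀ ℕ, IsDecompositionOf A f M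
  then (Classical.choose h).mapRange (fun m : ℕ => (m : ℤ)) (by simp)
  else 0

/-- A choice of syzygy module `Ω(M)` (junk value `0` if no projective cover exists). -/
def syzygyModule (M : ModuleCat.{0} A) : ModuleCat.{0} A :=
  if h : ∃ N : ModuleCat.{0} A, IsSyzygyOf A N M then Classical.choose h
  else ModuleCat.of A PUnit

/-- The Igusa–Todorov endomorphism `L` of the free abelian group on indecomposables,
sending `[M] ↦ [Ω M]`. -/
def syzygyEnd : AddMonoid.End (K0Group A) :=
  Finsupp.liftAddHom fun x : IndecIso A =>
    (zmultiplesHom (K0Group A)) (decompClass A (syzygyModule A (Quotient.out x).1))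

/-- The generators `[X]`, `X` an indecomposable direct summand of `M`, of the subgroup
`⟨add M⟩`. -/
def addGenerators (M : ModuleCat.{0} A) : Set (K0Group A) :=
  {g | ∃ (X : ModuleCat.{0} A) (h : Module.Finite A ↥X ∧ IndecomposableModule A X),
      IsDirectSummandOf A X M ∧ g = Finsupp.single (Quotient.mk (indecSetoid A) ⟨X, h⟩) 1}

/-- The Igusa–Todorov function `φ(M)`: the least `t` at which the rank of
`L^t⟨add M⟩` stabilizes. -/
def phiMod (M : ModuleCat.{0} A) : ℕ∞ :=
  sInf ((fun n : ℕ => (n : ℕ∞)) ''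
    {t : ℕ | ∀ j : ℕ, 1 ≤ j →
      Module.finrank ℤ
        ↥(AddSubgroup.map ((syzygyEnd A) ^ t) (AddSubgroup.closure (addGenerators A M))) =
      Module.finrank ℤ
        ↥(AddSubgroup.map ((syzygyEnd A) ^ (t + j)) (AddSubgroup.closure (addGenerators A M)))})

/-- The `φ`-dimension of the algebra. -/
def phiDim : ℕ∞ :=
  sSup {d : ℕ∞ | ∃ M : ModuleCat.{0} A, Module.Finite A ↥M ∧ phiMod A M = d}

end Phi

section Epsilon

variable (A : Type) [Ring A]

/-- `T` is (isomorphic to) the socle of some indecomposable projective module. -/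
def IsSocleOfIndecProjective (T : ModuleCat.{0} A) : Prop :=
  IsSimpleModule A ↥T ∧ ∃ Q : ModuleCat.{0} A, Module.Projective A ↥Q ∧ Module.Finite A ↥Q ∧
    IndecomposableModule A Q ∧ Nonempty (↥T ≃ₗ[A] ↥(socleOf A Q))

/-- `S` belongs to `S'(Λ)`: `S ≅ S_{i+1}` where `S_i` is a socle of an indecomposable
projective; here `S_{i+1} = top (rad P(S_i))` for the cyclic quiver. -/
def IsInSPrime (S : ModuleCat.{0} A) : Prop :=
  IsSimpleModule A ↥S ∧ ∃ T P : ModuleCat.{0} A, IsSocleOfIndecProjective A T ∧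
    IsProjCoverOf A P T ∧ Nonempty ((topOf A ↥(radOf A ↥P)) ≃ₗ[A] ↥S)

/-- `B` is (isomorphic to) the syzygy filtered algebra
`ε(Λ) = End_Λ(⊕_{S ∈ S'(Λ)} P(S))`. -/
def IsSyzygyFilteredAlgebra (B : Type) [Ring B] : Prop :=
  ∃ (ι : Type) (_ : Fintype ι) (Sf Pf : ι → ModuleCat.{0} A),
    (∀ i, IsInSPrime A (Sf i) ∧ IsProjCoverOf A (Pf i) (Sf i)) ∧
    (∀ i j, Nonempty (↥(Sf i) ≃ₗ[A] ↥(Sf j)) → i = j) ∧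
    (∀ S : ModuleCat.{0} A, IsInSPrime A S → ∃ i, Nonempty (↥S ≃ₗ[A] ↥(Sf i))) ∧
    Nonempty (B ≃+* Module.End A (DirectSum ι fun i => ↥(Pf i)))

/-- `B` is (isomorphic to) the `d`-th iterated syzygy filtered algebra `ε^d(Λ)`,
each intermediate step being a cyclic non-selfinjective Nakayama algebra. -/
def IsIterSyzygyFiltered (d : ℕ) (B : Type) [Ring B] : Prop :=
  ∃ C : ℕ → RingCat.{0},
    Nonempty (A ≃+* ↥(C 0)) ∧ Nonempty (↥(C d) ≃+* B) ∧
    ∀ i < d, IsCyclicNakayama ↥(C i) ∧ ¬ IsSelfinjectiveRing ↥(C i) ∧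
      IsSyzygyFilteredAlgebra ↥(C i) ↥(C (i + 1))

end Epsilon

namespace CyclicNakayama

section Combinatorics

/-- For a permutation `σ` of the simple modules and their projective lengths `c`, this says that
`c` does not drop in the step into any `σ ^ c i i`, and that it drops in some step. -/
def DropsAwayFromTargets {ι : Type} (σ : Equiv.Perm ι) (c : ι → ℕ) : Prop :=
  (∀ i, c (σ⁻¹ ((σ ^ c i) i)) ≤ c ((σ ^ c i) i)) ∧ ∃ i, c (σ i) < c i

variable {ι : Type} {σ : Equiv.Perm ι} {c d : ι → ℕ}

lemma perm_apply_inv (σ : Equiv.Perm ι) (i : ι) : σ (σ⁻¹ i) = i :=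
  σ.apply_symm_apply i

lemma perm_inv_apply (σ : Equiv.Perm ι) (i : ι) : σ⁻¹ (σ i) = i :=
  σ.symm_apply_apply i

lemma le_iterate_add (hc : ∀ i, c i ≤ c (σ i) + 1) (k : ℕ) (i : ι) :
    c i ≤ c ((σ ^ k) i) + k := by
  induction k generalizing i with
  | zero => simp
  | succ k ih =>
    have h1 := hc i
    have h2 := ih (σ i)
    rw [pow_succ, Equiv.Perm.mul_apply]
    omega

lemma eq_of_target_eq (hc : ∀ i, c i ≤ c (σ i) + 1) {i j : ι} (hj : c (σ⁻¹ j) ≤ c j)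
    (hij : (σ ^ c i) i = (σ ^ c j) j) (hle : c j ≤ c i) : i = j := by
  obtain ⟨m, hm⟩ := Nat.exists_eq_add_of_le hle
  have hjm : (σ ^ m) i = j := by
    rw [hm, pow_add, Equiv.Perm.mul_apply] at hij
    exact (σ ^ c j).injective hij
  cases m with
  | zero => simpa using hjm
  | succ m =>
    have hprev : σ⁻¹ j = (σ ^ m) i := by
      rw [← hjm, pow_succ', Equiv.Perm.mul_apply, perm_inv_apply]
    have := le_iterate_add hc m i
    rw [hprev] at hj
    omega

lemma exists_start_of_target [Finite ι] (hc : ∀ i, c i ≤ c (σ i) + 1) (i : ι) :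
    ∃ j, c (σ⁻¹ j) ≤ c j ∧ (σ ^ c j) j = (σ ^ c i) i := by
  obtain ⟨b, hb⟩ := (Set.finite_range c).bddAbove
  have hb' : ∀ i, c i ≤ b := fun i => hb ⟨i, rfl⟩
  induction hn : b - c i using Nat.strong_induction_on generalizing i with
  | _ n ih =>
    by_cases h : c (σ⁻¹ i) ≤ c i
    · exact ⟨i, h, rfl⟩
    · have h1 := hc (σ⁻¹ i)
      rw [perm_apply_inv] at h1
      have h2 := hb' (σ⁻¹ i)
      obtain ⟨j, hj, hji⟩ := ih (b - c (σ⁻¹ i)) (by omega) (σ⁻¹ i) rfl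
      refine ⟨j, hj, hji.trans ?_⟩
      have h3 : c (σ⁻¹ i) = c i + 1 := by omega
      rw [h3, pow_succ, Equiv.Perm.mul_apply, perm_apply_inv]

lemma ncard_range_target [Finite ι] (hc : ∀ i, c i ≤ c (σ i) + 1) :
    (Set.range fun i => (σ ^ c i) i).ncard = {t | c (σ⁻¹ t) ≤ c t}.ncard := by
  have himage : (fun i => (σ ^ c i) i) '' {t | c (σ⁻¹ t) ≤ c t} =
      Set.range fun i => (σ ^ c i) i := by
    apply Set.Subset.antisymm (Set.image_subset_range _ _)
    rintro _ ⟨i, rfl⟩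
    obtain ⟨j, hj, hji⟩ := exists_start_of_target hc i
    exact ⟨j, hj, hji⟩
  rw [← himage]
  refine Set.InjOn.ncard_image fun i hi j hj hij => ?_
  rcases le_total (c j) (c i) with h | h
  · exact eq_of_target_eq hc hj hij h
  · exact (eq_of_target_eq hc hi hij.symm h).symm

lemma exists_target_eq_iff (hc : ∀ i, 0 < c i) (hd : ∀ i, 0 < d i)
    (hcd : ∀ i k, k < c i ↔ k < d ((σ ^ k) i)) (j : ι) :
    (∃ i, (σ ^ c i) i = σ j) ↔ d (σ j) ≤ d j := by
  constructor
  · rintro ⟨i, hi⟩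
    obtain ⟨m, hm⟩ : ∃ m, c i = m + 1 := ⟨c i - 1, by have := hc i; omega⟩
    have h1 := hcd i (m + 1)
    have h2 := hcd i m
    rw [← hm, hi] at h1
    have h3 : (σ ^ m) i = j := by
      rw [hm, pow_succ', Equiv.Perm.mul_apply] at hi
      exact σ.injective hi
    rw [h3] at h2
    omega
  · intro h
    obtain ⟨m, hm⟩ : ∃ m, d j = m + 1 := ⟨d j - 1, by have := hd j; omega⟩
    have hmj : (σ ^ m) ((σ ^ m)⁻¹ j) = j := perm_apply_inv _ _
    have hmj' : (σ ^ (m + 1)) ((σ ^ m)⁻¹ j) = σ j := by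
      rw [pow_succ', Equiv.Perm.mul_apply, hmj]
    have h1 := hcd ((σ ^ m)⁻¹ j) (m + 1)
    have h2 := hcd ((σ ^ m)⁻¹ j) m
    rw [hmj'] at h1
    rw [hmj] at h2
    refine ⟨(σ ^ m)⁻¹ j, ?_⟩
    have h3 : c ((σ ^ m)⁻¹ j) = m + 1 := by omega
    rw [h3, hmj']

lemma dropsAwayFromTargets_iff [Finite ι] (hcσ : ∀ i, c i ≤ c (σ i) + 1) :
    DropsAwayFromTargets σ c ↔
      (Set.range fun i => (σ ^ c i) i) = {t | c (σ⁻¹ t) ≤ c t} ∧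
        {t | c (σ⁻¹ t) ≤ c t} ≠ Set.univ := by
  have hne : (∃ i, c (σ i) < c i) ↔ {t | c (σ⁻¹ t) ≤ c t} ≠ Set.univ := by
    rw [Set.ne_univ_iff_exists_notMem]
    constructor
    · rintro ⟨i, hi⟩
      exact ⟨σ i, by simpa using hi⟩
    · rintro ⟨i, hi⟩
      exact ⟨σ⁻¹ i, by simpa using hi⟩
  unfold DropsAwayFromTargets
  rw [hne]
  refine and_congr_left fun _ => ⟨fun h => ?_, fun h i => ?_⟩
  · refine Set.eq_of_subset_of_ncard_le ?_ (ncard_range_target hcσ).ge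
    rintro _ ⟨i, rfl⟩
    exact h i
  · exact h.subset ⟨i, rfl⟩

/-- The condition is symmetric: `d` plays the role of the lengths of the right projectives. -/
theorem dropsAwayFromTargets_inv [Finite ι] (hcσ : ∀ i, c i ≤ c (σ i) + 1)
    (hdσ : ∀ i, d i ≤ d (σ⁻¹ i) + 1) (hc : ∀ i, 0 < c i) (hd : ∀ i, 0 < d i)
    (hcd : ∀ i k, k < c i ↔ k < d ((σ ^ k) i)) :
    DropsAwayFromTargets σ c ↔ DropsAwayFromTargets σ⁻¹ d := by
  have hdc : ∀ i k, k < d i ↔ k < c (((σ⁻¹) ^ k) i) := fun i k => by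
    rw [hcd, inv_pow, perm_apply_inv]
  have h1 : (Set.range fun i => (σ ^ c i) i) = {t | d t ≤ d (σ⁻¹ t)} := by
    ext t
    have := exists_target_eq_iff hc hd hcd (σ⁻¹ t)
    rwa [perm_apply_inv] at this
  have h2 : (Set.range fun i => ((σ⁻¹) ^ d i) i) = {t | c t ≤ c (σ t)} := by
    ext t
    have := exists_target_eq_iff hd hc hdc (σ t)
    rwa [perm_inv_apply] at this
  have himage : ∀ f : ι → ℕ, {t | f (σ⁻¹ t) ≤ f t} = σ '' {t | f t ≤ f (σ t)} := fun f => by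
    ext t
    simp [Equiv.image_eq_preimage_symm, Equiv.Perm.inv_def]
  have himage' : {t | d t ≤ d (σ⁻¹ t)} = σ '' {t | d (σ t) ≤ d t} := by
    ext t
    simp [Equiv.image_eq_preimage_symm, Equiv.Perm.inv_def]
  rw [dropsAwayFromTargets_iff hcσ, dropsAwayFromTargets_iff hdσ, h1, h2, himage, himage',
    inv_inv, σ.injective.image_injective.eq_iff]
  constructor
  · rintro ⟨h, hne⟩
    exact ⟨h.symm, fun hu => hne (by rw [← h, hu, Set.image_univ, σ.surjective.range_eq])⟩
  · rintro ⟨h, hne⟩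
    exact ⟨h.symm, fun hu => hne (by
      rw [h, ← Set.image_univ_of_surjective σ.surjective] at hu
      exact σ.injective.image_injective hu)⟩

end Combinatorics

section Idempotents

open MulOpposite

variable {A : Type} [Ring A]

/-- A nonzero idempotent that is not a sum of two nonzero orthogonal idempotents. -/
def IsPrimitiveIdem (e : A) : Prop :=
  e * e = e ∧ e ≠ 0 ∧ ∀ f, f * f = f → e * f = f → f * e = f → f = 0 ∨ f = e

lemma IsPrimitiveIdem.op {e : A} (he : IsPrimitiveIdem e) : IsPrimitiveIdem (op e) := by
  refine ⟨by rw [← op_mul, he.1], by simpa using he.2.1, fun f hf hef hfe => ?_⟩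
  have := he.2.2 (unop f) (by rw [← unop_mul, hf]) (by simpa using congrArg unop hfe)
    (by simpa using congrArg unop hef)
  exact this.imp (fun h => unop_injective (by simpa using h))
    fun h => unop_injective (by simpa using h)

lemma mem_closure_isPrimitiveIdem [hA : IsArtinianRing A] (e : A) (he : e * e = e) :
    e ∈ AddSubmonoid.closure {f : A | IsPrimitiveIdem f} := by
  have key : ∀ (I : Submodule A A) (e : A), e * e = e → Submodule.span A {e} = I →
      e ∈ AddSubmonoid.closure {f : A | IsPrimitiveIdem f} := by
    intro I
    induction I using WellFoundedLT.induction with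
    | _ I ih =>
      intro e he hI
      by_cases h0 : e = 0
      · exact h0 ▸ zero_mem _
      by_cases hp : IsPrimitiveIdem e
      · exact AddSubmonoid.subset_closure hp
      obtain ⟨f, hf, hef, hfe, hf0, hfe'⟩ :
          ∃ f, f * f = f ∧ e * f = f ∧ f * e = f ∧ f ≠ 0 ∧ f ≠ e := by
        by_contra! hcon
        refine hp ⟨he, h0, fun f hf hef hfe => ?_⟩
        by_contra! hh
        exact hh.2 (hcon f hf hef hfe hh.1)
      have lt_of : ∀ g h : A, g * e = g → g * h = 0 → e * h ≠ 0 →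
          Submodule.span A {g} < I := by
        intro g h hge hgh heh
        rw [← hI]
        refine lt_of_le_of_ne ?_ fun heq => heh ?_
        · rw [Submodule.span_singleton_le_iff_mem, Submodule.mem_span_singleton]
          exact ⟨g, hge⟩
        · have : e ∈ Submodule.span A {g} := heq ▸ Submodule.mem_span_singleton_self e
          obtain ⟨a, rfl⟩ := Submodule.mem_span_singleton.1 this
          rw [smul_eq_mul, mul_assoc, hgh, mul_zero]
      have hsub : f + (e - f) = e := by abel
      rw [← hsub]
      refine add_mem (ih _ (lt_of f (e - f) hfe ?_ ?_) f hf rfl)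
        (ih _ (lt_of (e - f) f ?_ ?_ ?_) (e - f) ?_ rfl)
      · rw [mul_sub, hfe, hf, sub_self]
      · rw [mul_sub, he, hef]
        exact sub_ne_zero.2 hfe'.symm
      · rw [sub_mul, he, hfe]
      · rw [sub_mul, hef, hf, sub_self]
      · rwa [hef]
      · rw [mul_sub, sub_mul, sub_mul, he, hef, hfe, hf]
        abel
  exact key _ e he rfl

/-- The elements of the left module `M` are linearly ordered by divisibility. -/
def IsChainModule (A M : Type) [Ring A] [AddCommGroup M] [Module A M] : Prop :=
  ∀ x y : M, (∃ a : A, x = a • y) ∨ ∃ a : A, y = a • x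

lemma isChainModule_of_isUniserial {M : ModuleCat.{0} A} (hM : IsUniserialModule A M) :
    IsChainModule A M := by
  intro x y
  refine (hM (Submodule.span A {x}) (Submodule.span A {y})).imp (fun h => ?_) fun h => ?_
  · obtain ⟨a, ha⟩ := Submodule.mem_span_singleton.1 (h (Submodule.mem_span_singleton_self x))
    exact ⟨a, ha.symm⟩
  · obtain ⟨a, ha⟩ := Submodule.mem_span_singleton.1 (h (Submodule.mem_span_singleton_self y))
    exact ⟨a, ha.symm⟩

lemma IsChainModule.exists_generator {M : Type} [AddCommGroup M] [Module A M] [IsNoetherian A M]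
    (hM : IsChainModule A M) : ∃ x : M, ∀ z : M, ∃ a : A, z = a • x := by
  obtain ⟨_, ⟨x, rfl⟩, hx⟩ := WellFounded.has_min
    (wellFounded_gt : WellFounded ((· > ·) : Submodule A M → Submodule A M → Prop))
    (Set.range fun x : M => Submodule.span A {x}) ⟨_, 0, rfl⟩
  refine ⟨x, fun z => ?_⟩
  rcases hM z x with h | ⟨a, ha⟩
  · exact h
  have hle : Submodule.span A {x} ≤ Submodule.span A {z} := by
    rw [Submodule.span_singleton_le_iff_mem, Submodule.mem_span_singleton]
    exact ⟨a, ha.symm⟩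
  have hz : z ∈ Submodule.span A {x} := by
    rw [hle.eq_of_not_lt (hx _ ⟨z, rfl⟩)]
    exact Submodule.mem_span_singleton_self z
  obtain ⟨b, hb⟩ := Submodule.mem_span_singleton.1 hz
  exact ⟨b, hb.symm⟩

/-- The two-sided ideal generated by the `e i` is the whole ring. -/
def GeneratesRing {ι : Type} (e : ι → A) : Prop :=
  (1 : A) ∈ AddSubmonoid.closure {r : A | ∃ a i b, r = a * e i * b}

lemma GeneratesRing.op {ι : Type} {e : ι → A} (h : GeneratesRing e) :
    GeneratesRing fun i => MulOpposite.op (e i) := by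
  have key : ∀ r ∈ AddSubmonoid.closure {r : A | ∃ a i b, r = a * e i * b},
      MulOpposite.op r ∈ AddSubmonoid.closure {r : Aᵐᵒᵖ | ∃ a i b, r = a * MulOpposite.op (e i) * b} := by
    intro r hr
    induction hr using AddSubmonoid.closure_induction with
    | mem r hr =>
      obtain ⟨a, i, b, rfl⟩ := hr
      exact AddSubmonoid.subset_closure ⟨MulOpposite.op b, i, MulOpposite.op a, by simp [mul_assoc]⟩
    | zero => exact zero_mem _
    | add r s _ _ hr hs => exact add_mem hr hs
  exact key 1 h

lemma IsChainModule.exists_idem_generator {M : Type} [AddCommGroup M] [Module A M]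
    (hM : IsChainModule A M) {ι : Type} {e : ι → A} (he : GeneratesRing e) {x : M} (hx0 : x ≠ 0)
    (hx : ∀ z : M, ∃ a : A, z = a • x) : ∃ (j : ι) (m : M), ∀ z : M, ∃ a : A, z = a • e j • m := by
  have key : ∀ r ∈ AddSubmonoid.closure {r : A | ∃ a i b, r = a * e i * b},
      (∃ a : A, x = a • r • x) → ∃ (j : ι) (b : A), ∃ a : A, x = a • e j • b • x := by
    intro r hr
    induction hr using AddSubmonoid.closure_induction with
    | mem r hr =>
      obtain ⟨a, i, b, rfl⟩ := hr
      rintro ⟨a', ha'⟩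
      exact ⟨i, b, a' * a, by simpa [mul_smul] using ha'⟩
    | zero =>
      rintro ⟨a, ha⟩
      exact absurd (by simpa using ha) hx0
    | add r s _ _ hr hs =>
      rintro ⟨a, ha⟩
      rcases hM (r • x) (s • x) with ⟨b, hb⟩ | ⟨b, hb⟩
      · exact hs ⟨a * (b + 1), by rw [mul_smul, add_smul, one_smul, ← hb, ← add_smul, ← ha]⟩
      · exact hr ⟨a * (1 + b), by rw [mul_smul, add_smul, one_smul, ← hb, ← add_smul, ← ha]⟩
  obtain ⟨j, b, a, ha⟩ := key 1 he ⟨1, by simp⟩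
  refine ⟨j, b • x, fun z => ?_⟩
  obtain ⟨c, hc⟩ := hx z
  exact ⟨c * a, by rw [mul_smul, ← ha, hc]⟩

/-- The elements of `A e` are linearly ordered by left divisibility. -/
def LeftChain (e : A) : Prop :=
  ∀ x y, x * e = x → y * e = y → (∃ a, x = a * y) ∨ ∃ a, y = a * x

lemma mem_span_idem_iff {e : A} (he : e * e = e) {x : A} :
    x ∈ Submodule.span A {e} ↔ x * e = x := by
  rw [Submodule.mem_span_singleton]
  constructor
  · rintro ⟨a, rfl⟩
    rw [smul_eq_mul, mul_assoc, he]
  · exact fun h => ⟨x, h⟩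

lemma IsPrimitiveIdem.indecomposable {e : A} (he : IsPrimitiveIdem e) :
    IndecomposableModule A (ModuleCat.of A (Submodule.span A {e})) := by
  have hmem : ∀ z : Submodule.span A {e}, (z : A) * e = z := fun z =>
    (mem_span_idem_iff he.1).1 z.2
  let g : Submodule.span A {e} := ⟨e, Submodule.mem_span_singleton_self e⟩
  have hg : ∀ z : Submodule.span A {e}, z = (z : A) • g := fun z =>
    Subtype.ext (hmem z).symm
  have top_of_mem : ∀ N : Submodule A (Submodule.span A {e}), g ∈ N → N = ⊤ := fun N h =>
    (Submodule.eq_top_iff').2 fun z => hg z ▸ N.smul_mem _ h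
  refine ⟨⟨g, 0, fun h => he.2.1 (congrArg Subtype.val h)⟩, fun N N' hc => ?_⟩
  change Submodule A (Submodule.span A {e}) at N N'
  obtain ⟨n, hn, n', hn', hsum⟩ := Submodule.mem_sup.1
    (hc.sup_eq_top ▸ Submodule.mem_top : g ∈ N ⊔ N')
  have hsum' : (n : A) + n' = e := congrArg Subtype.val hsum
  have zero_of : ∀ z, z ∈ N → z ∈ N' → z = 0 := fun z h h' => by
    have : z ∈ N ⊓ N' := ⟨h, h'⟩
    rwa [hc.inf_eq_bot, Submodule.mem_bot] at this
  have expand : ∀ m : Submodule.span A {e}, m = (m : A) • n + (m : A) • n' := fun m => by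
    rw [← smul_add, hsum]
    exact hg m
  have hnn' : (n : A) • n' = 0 := zero_of _
    ((eq_sub_of_add_eq' (expand n).symm) ▸ sub_mem hn (N.smul_mem _ hn)) (N'.smul_mem _ hn')
  have hn'n : (n' : A) • n = 0 := zero_of _ (N.smul_mem _ hn)
    ((eq_sub_of_add_eq (expand n').symm) ▸ sub_mem hn' (N'.smul_mem _ hn'))
  have h1 : (n : A) * n' = 0 := congrArg Subtype.val hnn'
  have h2 : (n' : A) * n = 0 := congrArg Subtype.val hn'n
  have h3 : (n : A) * n = n := by
    calc (n : A) * n = n * (n + n') := by rw [mul_add, h1, add_zero]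
      _ = n := (congrArg _ hsum').trans (hmem n)
  have h4 : e * n = n := by
    calc e * n = (n + n') * (n : A) := congrArg (· * (n : A)) hsum'.symm
      _ = n := by rw [add_mul, h2, h3, add_zero]
  rcases he.2.2 n h3 h4 (hmem n) with h | h
  · left
    have hgN' : g ∈ N' := by
      rw [← hsum, show n = 0 from Subtype.ext h, zero_add]
      exact hn'
    have := hc.inf_eq_bot
    rwa [top_of_mem N' hgN', inf_top_eq] at this
  · right
    exact top_of_mem N (by rwa [show n = g from Subtype.ext h] at hn)

lemma IsPrimitiveIdem.leftChain (hA : IsNakayamaRing A) {e : A} (he : IsPrimitiveIdem e) :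
    LeftChain e := by
  have hchain := isChainModule_of_isUniserial
    (hA.2 (ModuleCat.of A (Submodule.span A {e})) (inferInstanceAs (Module.Finite A
      (Submodule.span A {e}))) he.indecomposable)
  intro x y hx hy
  refine (hchain ⟨x, (mem_span_idem_iff he.1).2 hx⟩ ⟨y, (mem_span_idem_iff he.1).2 hy⟩).imp ?_ ?_
  · exact fun ⟨a, ha⟩ => ⟨a, congrArg Subtype.val ha⟩
  · exact fun ⟨a, ha⟩ => ⟨a, congrArg Subtype.val ha⟩

lemma exists_inverse {e f x a : A} (he : IsPrimitiveIdem e) (hf : IsPrimitiveIdem f)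
    (hfx : f * x = x) (hxe : x * e = x) (hax : a * x = e) :
    ∃ b, e * b = b ∧ b * f = b ∧ b * x = e ∧ x * b = f := by
  have hbx : e * a * f * x = e := by rw [mul_assoc, hfx, mul_assoc, hax, he.1]
  refine ⟨e * a * f, by simp only [← mul_assoc, he.1], by rw [mul_assoc, hf.1], hbx, ?_⟩
  have hidem : x * (e * a * f) * (x * (e * a * f)) = x * (e * a * f) := by
    rw [mul_assoc x, ← mul_assoc (e * a * f), hbx, ← mul_assoc x, hxe]
  refine (hf.2.2 _ hidem (by rw [← mul_assoc, hfx]) (by rw [mul_assoc, mul_assoc, hf.1])).resolve_left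
    fun h => he.2.1 ?_
  calc e = (e * a * f * x) * (e * a * f * x) := by rw [hbx, he.1]
    _ = e * a * f * (x * (e * a * f)) * x := by simp only [mul_assoc]
    _ = 0 := by rw [h, mul_zero, zero_mul]

lemma exists_right_inverse_iff {e f x : A} (he : IsPrimitiveIdem e) (hf : IsPrimitiveIdem f)
    (hfx : f * x = x) (hxe : x * e = x) : (∃ b, x * b = f) ↔ ∃ a, a * x = e := by
  constructor
  · rintro ⟨b, hb⟩
    obtain ⟨a, -, -, -, ha⟩ := exists_inverse hf.op he.op (x := op x) (a := op b)
      (by rw [← op_mul, hxe]) (by rw [← op_mul, hfx]) (by rw [← op_mul, hb])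
    exact ⟨unop a, op_injective (by simpa using ha)⟩
  · rintro ⟨a, ha⟩
    obtain ⟨b, -, -, -, hb⟩ := exists_inverse he hf hfx hxe ha
    exact ⟨b, hb⟩

lemma LeftChain.isLocal {e z : A} (he : LeftChain e) (hidem : e * e = e) (hz : z * e = z) :
    (∃ a, a * z = e) ∨ ∃ a, a * (e - z) = e := by
  rcases he z (e - z) hz (by rw [sub_mul, hidem, hz]) with ⟨a, ha⟩ | ⟨a, ha⟩
  · exact Or.inr ⟨a + 1, by rw [add_mul, ← ha, one_mul]; abel⟩
  · exact Or.inl ⟨a + 1, by rw [add_mul, ← ha, one_mul]; abel⟩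

/-- The non-generators of the uniserial left ideal `A e`. -/
def nonGenerators {e : A} (h0 : e ≠ 0) (he : LeftChain e) : Submodule A A where
  carrier := {x | x * e = x ∧ ¬ ∃ a, a * x = e}
  zero_mem' := ⟨zero_mul e, fun ⟨a, ha⟩ => h0 (by rw [← ha, mul_zero])⟩
  add_mem' := by
    rintro x y ⟨hx, hx'⟩ ⟨hy, hy'⟩
    refine ⟨by rw [add_mul, hx, hy], fun ⟨a, ha⟩ => ?_⟩
    rcases he x y hx hy with ⟨b, hb⟩ | ⟨b, hb⟩
    · exact hy' ⟨a * (b + 1), by rw [mul_assoc, add_mul, one_mul, ← hb, ha]⟩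
    · exact hx' ⟨a * (1 + b), by rw [mul_assoc, add_mul, one_mul, ← hb, ha]⟩
  smul_mem' := by
    rintro c x ⟨hx, hx'⟩
    exact ⟨by rw [smul_eq_mul, mul_assoc, hx],
      fun ⟨a, ha⟩ => hx' ⟨a * c, by rw [mul_assoc]; exact ha⟩⟩

lemma LeftChain.exists_max_generator [IsNoetherianRing A] {ι : Type} {f : ι → A}
    (hf : GeneratesRing f) (hidemf : ∀ i, f i * f i = f i) {e x : A} (he : LeftChain e)
    (h0 : e ≠ 0)
    (hx : x * e = x) (hx0 : x ≠ 0) (hx' : ¬ ∃ a, a * x = e) :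
    ∃ j y, f j * y = y ∧ y * e = y ∧ y ≠ 0 ∧ (¬ ∃ a, a * y = e) ∧
      ∀ z, z * e = z → (∃ a, a * z = e) ∨ ∃ a, z = a * y := by
  let L := nonGenerators h0 he
  have hL : IsChainModule A L := by
    intro z w
    refine (he z w z.2.1 w.2.1).imp ?_ ?_
    · exact fun ⟨a, ha⟩ => ⟨a, Subtype.ext ha⟩
    · exact fun ⟨a, ha⟩ => ⟨a, Subtype.ext ha⟩
  obtain ⟨w, hw⟩ := hL.exists_generator
  have hw0 : w ≠ 0 := by
    rintro rfl
    obtain ⟨a, ha⟩ := hw ⟨x, hx, hx'⟩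
    rw [smul_zero] at ha
    exact hx0 (congrArg Subtype.val ha)
  obtain ⟨j, m, hm⟩ := hL.exists_idem_generator hf hw0 hw
  have hy : f j * (f j * (m : A)) = f j * m := by rw [← mul_assoc, hidemf]
  refine ⟨j, f j * m, hy, (f j • m).2.1, fun h => hw0 ?_, (f j • m).2.2, fun z hz => ?_⟩
  · obtain ⟨a, ha⟩ := hm w
    rw [ha, show f j • m = 0 from Subtype.ext h, smul_zero]
  · by_cases hz' : ∃ a, a * z = e
    · exact Or.inl hz'
    · obtain ⟨a, ha⟩ := hm ⟨z, hz, hz'⟩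
      exact Or.inr ⟨a, congrArg Subtype.val ha⟩

end Idempotents

section Datum

open MulOpposite

variable {A : Type} [Ring A] {ι : Type}

/-- The product of the arrows `y` along the path of length `k` which starts at `i`. -/
def pathProd (e y : ι → A) (σ : Equiv.Perm ι) : ℕ → ι → A
  | 0, i => e i
  | k + 1, i => pathProd e y σ k (σ i) * y i

/-- A presentation of a ring by a family of uniserial idempotents, permuted by `σ`, with arrows
`y i` from `i` to `σ i` that generate the radicals of `A e i` and of `e (σ i) A`. -/
structure SerialDatum (A : Type) [Ring A] (ι : Type) where
  e : ι → A
  y : ι → A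
  σ : Equiv.Perm ι
  e_mul_e : ∀ i, e i * e i = e i
  e_mul_y : ∀ i, e (σ i) * y i = y i
  y_mul_e : ∀ i, y i * e i = y i
  y_ne_zero : ∀ i, y i ≠ 0
  y_not_left : ∀ i, ¬ ∃ a, a * y i = e i
  y_not_right : ∀ i, ¬ ∃ a, y i * a = e (σ i)
  left_max : ∀ i x, x * e i = x → (∃ a, a * x = e i) ∨ ∃ a, x = a * y i
  right_max : ∀ i x, e (σ i) * x = x → (∃ a, x * a = e (σ i)) ∨ ∃ a, x = y i * a
  generates : GeneratesRing e
  nilpotent : ∃ n, ∀ i, pathProd e y σ n i = 0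

lemma pathProd_succ' {e y : ι → A} {σ : Equiv.Perm ι} (hy : ∀ i, e (σ i) * y i = y i)
    (hy' : ∀ i, y i * e i = y i) (k : ℕ) (i : ι) :
    pathProd e y σ (k + 1) i = y ((σ ^ k) i) * pathProd e y σ k i := by
  induction k generalizing i with
  | zero => simp [pathProd, hy, hy']
  | succ k ih =>
    rw [pathProd, ih (σ i), pathProd, pow_succ, Equiv.Perm.mul_apply, mul_assoc]

lemma idem_mul_pathProd {e y : ι → A} {σ : Equiv.Perm ι} (he : ∀ i, e i * e i = e i)
    (k : ℕ) (i : ι) :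
    e ((σ ^ k) i) * pathProd e y σ k i = pathProd e y σ k i := by
  induction k generalizing i with
  | zero => exact he i
  | succ k ih => rw [pathProd, pow_succ, Equiv.Perm.mul_apply, ← mul_assoc, ih]

lemma exists_basic_idempotents [IsArtinianRing A] :
    ∃ (ι : Type) (_ : Finite ι) (e : ι → A), (∀ i, IsPrimitiveIdem (e i)) ∧ GeneratesRing e ∧
      ∀ i j x a, e j * x = x → x * e i = x → a * x = e i → i = j := by
  obtain ⟨l, hl, hsum⟩ := AddSubmonoid.exists_multiset_of_mem_closure
    (mem_closure_isPrimitiveIdem (1 : A) (one_mul 1))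
  let S := {f : A // f ∈ l.toFinset}
  have hS : ∀ f : S, IsPrimitiveIdem f.1 := fun f => hl _ (Multiset.mem_toFinset.1 f.2)
  let s : Setoid S :=
    { r := fun e f => ∃ x a : A, f.1 * x = x ∧ x * e.1 = x ∧ a * x = e.1
      iseqv :=
        { refl := fun e => ⟨e.1, e.1, (hS e).1, (hS e).1, (hS e).1⟩
          symm := fun {e f} ⟨x, a, h1, h2, h3⟩ => by
            obtain ⟨b, h4, h5, -, h6⟩ := exists_inverse (hS e) (hS f) h1 h2 h3
            exact ⟨b, x, h4, h5, h6⟩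
          trans := fun {e f g} ⟨x, a, h1, h2, h3⟩ ⟨y, b, h4, h5, h6⟩ =>
            ⟨y * x, a * b, by rw [← mul_assoc, h4], by rw [mul_assoc, h2], by
              rw [mul_assoc, ← mul_assoc b, h6, h1, h3]⟩ } }
  refine ⟨Quotient s, inferInstance, fun q => q.out.1, fun q => hS _, ?_, ?_⟩
  · unfold GeneratesRing
    rw [← hsum]
    refine multiset_sum_mem _ fun f hf => AddSubmonoid.subset_closure ?_
    obtain ⟨x, a, h1, h2, h3⟩ := Quotient.mk_out (s := s) ⟨f, Multiset.mem_toFinset.2 hf⟩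
    obtain ⟨b, -, -, -, h4⟩ := exists_inverse (hS _) (hl _ hf) h1 h2 h3
    exact ⟨x, _, b, by rw [h2, h4]⟩
  · intro i j x a h1 h2 h3
    rw [← Quotient.out_eq i, ← Quotient.out_eq j]
    exact Quotient.sound ⟨x, a, h1, h2, h3⟩

lemma projective_span_idem {e : A} (he : e * e = e) :
    Module.Projective A (Submodule.span A {e}) := by
  refine Module.Projective.of_split (Submodule.span A {e}).subtype
    (LinearMap.toSpanSingleton A (Submodule.span A {e})
      ⟨e, Submodule.mem_span_singleton_self e⟩) ?_
  ext z
  exact (mem_span_idem_iff he).1 z.2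

lemma exists_nonGenerator
    (hA : ∀ M : ModuleCat.{0} A, IsSimpleModule A M → ¬ Module.Projective A M)
    {e : A} (he : e * e = e) (h0 : e ≠ 0) : ∃ x, x * e = x ∧ x ≠ 0 ∧ ¬ ∃ a, a * x = e := by
  by_contra! hcon
  refine hA (ModuleCat.of A (Submodule.span A {e})) ?_ (projective_span_idem he)
  let g : Submodule.span A {e} := ⟨e, Submodule.mem_span_singleton_self e⟩
  have : Nontrivial (Submodule.span A {e}) := ⟨g, 0, fun h => h0 (congrArg Subtype.val h)⟩
  refine isSimpleModule_iff_toSpanSingleton_surjective.2 ⟨this, fun z hz w => ?_⟩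
  obtain ⟨a, ha⟩ := hcon z.1 ((mem_span_idem_iff he).1 z.2) fun h => hz (Subtype.ext h)
  refine ⟨(w : A) * a, Subtype.ext ?_⟩
  change (w : A) * a * z = w
  rw [mul_assoc, ha, (mem_span_idem_iff he).1 w.2]

lemma exists_left_inverse_of_factor {e g y y' a : A} (he : IsPrimitiveIdem g)
    (hchain : LeftChain g) (hgy : g * y = y) (hy0 : y ≠ 0)
    (hmax : ∀ z, z * e = z → (∃ b, b * z = e) ∨ ∃ b, z = b * y) (hgy' : g * y' = y')
    (hy' : ¬ ∃ b, y' * b = g) (hae : a * e = a) (hy : y = y' * a) : ∃ b, b * a = e := by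
  refine (hmax a hae).resolve_right fun ⟨b, hb⟩ => hy0 ?_
  have hz : y' * b * g * g = y' * b * g := by rw [mul_assoc, he.1]
  have hgz : g * (y' * b * g) = y' * b * g := by rw [← mul_assoc, ← mul_assoc, hgy']
  have hzy : y' * b * g * y = y := by rw [mul_assoc, hgy, mul_assoc, ← hb, ← hy]
  rcases hchain.isLocal he.1 hz with h | ⟨c, hc⟩
  · obtain ⟨c, hc⟩ := (exists_right_inverse_iff he he hgz hz).2 h
    exact absurd ⟨b * g * c, by simpa only [mul_assoc] using hc⟩ hy'
  · rw [← hgy, ← hc, mul_assoc, sub_mul, hgy, hzy, sub_self, mul_zero]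

lemma exists_pathProd_eq_zero [IsArtinianRing A] {e y : ι → A} {σ : Equiv.Perm ι}
    (he : ∀ i, e i * e i = e i) (hchain : ∀ i, LeftChain (e i)) (hy : ∀ i, e (σ i) * y i = y i)
    (hy' : ∀ i, y i * e i = y i) (hleft : ∀ i, ¬ ∃ a, a * y i = e i) (i : ι) :
    ∃ n, pathProd e y σ n i = 0 := by
  let F : ℕ →o (Submodule A A)ᵒᵈ :=
    ⟨fun n => OrderDual.toDual (Submodule.span A {pathProd e y σ n i}),
      monotone_nat_of_le_succ fun n => OrderDual.toDual_le_toDual.2 (by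
        rw [Submodule.span_singleton_le_iff_mem, Submodule.mem_span_singleton,
          pathProd_succ' hy hy']
        exact ⟨_, rfl⟩)⟩
  obtain ⟨n, hn⟩ := IsArtinian.monotone_stabilizes F
  refine ⟨n, ?_⟩
  have hspan : Submodule.span A {pathProd e y σ n i} = Submodule.span A {pathProd e y σ (n + 1) i} :=
    hn (n + 1) n.le_succ
  obtain ⟨a, ha⟩ := Submodule.mem_span_singleton.1
    (hspan ▸ Submodule.mem_span_singleton_self (pathProd e y σ n i))
  rw [pathProd_succ' hy hy', smul_eq_mul, ← mul_assoc] at ha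
  have hp := idem_mul_pathProd (y := y) (σ := σ) he n i
  rcases (hchain ((σ ^ n) i)).isLocal (he _)
    (z := a * y ((σ ^ n) i)) (by rw [mul_assoc, hy']) with ⟨c, hc⟩ | ⟨c, hc⟩
  · exact absurd ⟨c * a, by rw [mul_assoc, hc]⟩ (hleft ((σ ^ n) i))
  · rw [← hp, ← hc, mul_assoc, sub_mul, hp, ha, sub_self, mul_zero]

theorem exists_serialDatum (hA : IsCyclicNakayama A) :
    ∃ (ι : Type) (_ : Finite ι), Nonempty (SerialDatum A ι) := by
  obtain ⟨⟨hl, hr⟩, -, hsimple⟩ := hA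
  have : IsArtinianRing A := hl.1
  have : IsArtinianRing Aᵐᵒᵖ := hr.1
  obtain ⟨ι, hfin, e, hprim, hgen, hiso⟩ := exists_basic_idempotents (A := A)
  have hchain : ∀ i, LeftChain (e i) := fun i => (hprim i).leftChain hl
  have hmax : ∀ i, ∃ j y, e j * y = y ∧ y * e i = y ∧ y ≠ 0 ∧ (¬ ∃ a, a * y = e i) ∧
      ∀ z, z * e i = z → (∃ a, a * z = e i) ∨ ∃ a, z = a * y := fun i => by
    obtain ⟨x, hx, hx0, hx'⟩ := exists_nonGenerator hsimple (hprim i).1 (hprim i).2.1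
    exact (hchain i).exists_max_generator hgen (fun j => (hprim j).1) (hprim i).2.1
      hx hx0 hx'
  choose τ y hey hye hy0 hyl hleft using hmax
  have hyr : ∀ i, ¬ ∃ a, y i * a = e (τ i) := fun i =>
    (exists_right_inverse_iff (hprim i) (hprim (τ i)) (hey i) (hye i)).not.2 (hyl i)
  have hright : ∀ i x, e (τ i) * x = x → (∃ a, x * a = e (τ i)) ∨ ∃ a, x = y i * a := by
    intro i x hx
    obtain ⟨j, w, hw1, hw2, -, hw4, hw5⟩ := ((hprim (τ i)).op.leftChain hr).exists_max_generator
      hgen.op (fun j => (hprim j).op.1) (hprim (τ i)).op.2.1 (x := op (y i))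
      (by rw [← op_mul, hey]) (by simpa using hy0 i)
      (fun ⟨a, ha⟩ => hyr i ⟨unop a, op_injective (by simpa using ha)⟩)
    have hw1' : unop w * e j = unop w := op_injective (by simpa using hw1)
    have hw2' : e (τ i) * unop w = unop w := op_injective (by simpa using hw2)
    have hw4' : ¬ ∃ a, unop w * a = e (τ i) := fun ⟨a, ha⟩ =>
      hw4 ⟨op a, unop_injective (by simpa using ha)⟩
    have hw5' : ∀ z, e (τ i) * z = z → (∃ a, z * a = e (τ i)) ∨ ∃ a, z = unop w * a := fun z hz =>
      (hw5 (op z) (by rw [← op_mul, hz])).imp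
        (fun ⟨a, ha⟩ => ⟨unop a, op_injective (by simpa using ha)⟩)
        fun ⟨a, ha⟩ => ⟨unop a, op_injective (by simpa using ha)⟩
    obtain ⟨a, ha⟩ := (hw5' (y i) (hey i)).resolve_left (hyr i)
    have ha' : y i = unop w * (e j * a * e i) := by
      rw [← mul_assoc, ← mul_assoc, hw1', ← ha, hye]
    have hae : e j * a * e i * e i = e j * a * e i := by rw [mul_assoc, (hprim i).1]
    have hea : e j * (e j * a * e i) = e j * a * e i := by
      rw [← mul_assoc, ← mul_assoc, (hprim j).1]
    obtain ⟨c, hc⟩ := (exists_right_inverse_iff (hprim i) (hprim j) hea hae).2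
      (exists_left_inverse_of_factor (hprim (τ i)) (hchain (τ i)) (hey i) (hy0 i) (hleft i)
        hw2' hw4' hae ha')
    refine (hw5' x hx).imp_right fun ⟨b, hb⟩ => ⟨c * b, ?_⟩
    rw [hb, ← mul_assoc, ha', mul_assoc (unop w), hc, hw1']
  have hinj : Function.Injective τ := by
    intro i i' h
    obtain ⟨a, ha⟩ := (hright i' (y i) (by rw [← h, hey])).resolve_left (by
      rw [← h]
      exact hyr i)
    have ha' : y i = y i' * (e i' * a * e i) := by
      rw [← mul_assoc, ← mul_assoc, hye, ← ha, hye]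
    have hae : e i' * a * e i * e i = e i' * a * e i := by rw [mul_assoc, (hprim i).1]
    have hea : e i' * (e i' * a * e i) = e i' * a * e i := by
      rw [← mul_assoc, ← mul_assoc, (hprim i').1]
    obtain ⟨b, hb⟩ := exists_left_inverse_of_factor (hprim (τ i)) (hchain (τ i)) (hey i) (hy0 i)
      (hleft i) (by rw [h, hey]) (by rw [h]; exact hyr i') hae ha'
    exact hiso i i' _ b hea hae hb
  let σ : Equiv.Perm ι := Equiv.ofBijective τ (Finite.injective_iff_bijective.1 hinj)
  have hzero : ∀ i, ∃ n, pathProd e y σ n i = 0 :=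
    exists_pathProd_eq_zero (fun i => (hprim i).1) hchain hey hye hyl
  choose n hn using hzero
  obtain ⟨N, hN⟩ := (Set.finite_range n).bddAbove
  have hmono : ∀ i k m, k ≤ m → pathProd e y σ k i = 0 → pathProd e y σ m i = 0 := by
    intro i k m hkm h
    induction m, hkm using Nat.le_induction with
    | base => exact h
    | succ m _ ih => rw [pathProd_succ' (σ := σ) hey hye, ih, mul_zero]
  exact ⟨ι, hfin, ⟨{
    e := e
    y := y
    σ := σ
    e_mul_e := fun i => (hprim i).1
    e_mul_y := hey
    y_mul_e := hye
    y_ne_zero := hy0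
    y_not_left := hyl
    y_not_right := hyr
    left_max := hleft
    right_max := hright
    generates := hgen
    nilpotent := ⟨N, fun i => hmono i (n i) N (hN ⟨i, rfl⟩) (hn i)⟩ }⟩⟩

end Datum

section HomologicalDimension

open CategoryTheory

variable {A : Type} [Ring A]

lemma projective_iff_hasProjectiveDimensionLT_one {M : ModuleCat.{0} A} :
    Module.Projective A M ↔ HasProjectiveDimensionLT M 1 := by
  rw [IsProjective.iff_projective, CategoryTheory.projective_iff_hasProjectiveDimensionLT_one]

lemma hasProjectiveDimensionLT_congr {M N : ModuleCat.{0} A} (e : N ≃ₗ[A] M) (n : ℕ) :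
    HasProjectiveDimensionLT M n ↔ HasProjectiveDimensionLT N n :=
  ⟨fun _ => hasProjectiveDimensionLT_of_iso e.symm.toModuleIso n,
    fun _ => hasProjectiveDimensionLT_of_iso e.toModuleIso n⟩

lemma isSyzygyOf_hasProjectiveDimensionLT_iff {N M : ModuleCat.{0} A} (h : IsSyzygyOf A N M)
    (n : ℕ) : HasProjectiveDimensionLT M (n + 2) ↔ HasProjectiveDimensionLT N (n + 1) := by
  obtain ⟨P, f, hP, -, hf, -, ⟨e⟩⟩ := h
  let S : ShortComplex (ModuleCat.{0} A) :=
    ⟨ModuleCat.ofHom (LinearMap.ker f).subtype, ModuleCat.ofHom f, by ext x; exact x.2⟩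
  have hS : S.ShortExact :=
    { exact := by
        rw [ShortComplex.ShortExact.moduleCat_exact_iff_function_exact]
        exact LinearMap.exact_subtype_ker_map f
      mono_f := (ModuleCat.mono_iff_injective _).2 (Submodule.injective_subtype _)
      epi_g := (ModuleCat.epi_iff_surjective _).2 hf }
  have hX : Projective S.X₂ := (IsProjective.iff_projective P).1 hP
  exact (hS.hasProjectiveDimensionLT_X₃_iff n hX).trans
    (hasProjectiveDimensionLT_congr (M := S.X₁) e (n + 1))

lemma isSyzygyOf_projective_iff {N M : ModuleCat.{0} A} (h : IsSyzygyOf A N M) :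
    Module.Projective A M ↔ Subsingleton N := by
  obtain ⟨P, f, hP, -, hf, hsmall, ⟨e⟩⟩ := h
  rw [e.toEquiv.subsingleton_congr, Submodule.subsingleton_iff_eq_bot]
  constructor
  · intro hM
    obtain ⟨s, hs⟩ := Module.projective_lifting_property f LinearMap.id hf
    have hsf : ∀ x, f (s x) = x := fun x => LinearMap.congr_fun hs x
    have htop : LinearMap.range s = ⊤ := hsmall _ (Submodule.eq_top_iff'.2 fun x => by
      refine Submodule.mem_sup.2 ⟨x - s (f x), ?_, s (f x), ⟨f x, rfl⟩, sub_add_cancel _ _⟩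
      rw [LinearMap.mem_ker, map_sub, hsf, sub_self])
    rw [Submodule.eq_bot_iff]
    intro x hx
    obtain ⟨m, rfl⟩ : x ∈ LinearMap.range s := htop ▸ Submodule.mem_top
    rw [LinearMap.mem_ker, hsf] at hx
    rw [hx, map_zero]
  · intro hker
    exact Module.Projective.of_equiv
      (LinearEquiv.ofBijective f ⟨LinearMap.ker_eq_bot.1 hker, hf⟩)

lemma isNthSyzygyOf_hasProjectiveDimensionLT_iff {n : ℕ} {N M : ModuleCat.{0} A}
    (h : IsNthSyzygyOf A n N M) (m : ℕ) :
    HasProjectiveDimensionLT M (n + m + 1) ↔ HasProjectiveDimensionLT N (m + 1) := by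
  induction n generalizing N m with
  | zero =>
    obtain ⟨e⟩ := h
    rw [zero_add]
    exact hasProjectiveDimensionLT_congr e (m + 1)
  | succ n ih =>
    obtain ⟨K, hK, hN⟩ := h
    rw [show n + 1 + m + 1 = n + (m + 1) + 1 by omega, ih hK]
    exact isSyzygyOf_hasProjectiveDimensionLT_iff hN m

lemma isNthSyzygyOf_finite [IsNoetherianRing A] {n : ℕ} {N M : ModuleCat.{0} A}
    (hM : Module.Finite A M) (h : IsNthSyzygyOf A n N M) : Module.Finite A N := by
  cases n with
  | zero =>
    obtain ⟨e⟩ := h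
    exact Module.Finite.equiv e.symm
  | succ n =>
    obtain ⟨K, -, P, f, -, hP, -, -, ⟨e⟩⟩ := h
    exact Module.Finite.equiv e.symm

lemma exists_isNthSyzygyOf_of_le {r n : ℕ} (hrn : r ≤ n) {N M : ModuleCat.{0} A}
    (h : IsNthSyzygyOf A n N M) : ∃ K, IsNthSyzygyOf A r K M := by
  induction n, hrn using Nat.le_induction generalizing N with
  | base => exact ⟨N, h⟩
  | succ n _ ih =>
    obtain ⟨K, hK, -⟩ := h
    exact ih hK

lemma finDim_le [IsNoetherianRing A] (n : ℕ)
    (h : ∀ M : ModuleCat.{0} A, Module.Finite A M →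
      HasProjectiveDimensionLT M (n + 2) → HasProjectiveDimensionLT M (n + 1)) :
    finDim A ≤ n := by
  refine sSup_le ?_
  rintro d ⟨hd, M, hM, hMd⟩
  by_contra! hlt
  let s := (fun n : ℕ => (n : ℕ∞)) ''
    {n : ℕ | ∃ N : ModuleCat.{0} A, IsNthSyzygyOf A n N M ∧ Module.Projective A ↥N}
  have hne : s.Nonempty := by
    by_contra hs
    rw [Set.not_nonempty_iff_eq_empty] at hs
    refine hd (hMd.symm.trans ?_)
    change sInf s = ⊤
    rw [hs, sInf_empty]
  obtain ⟨m, ⟨N, hN, hNproj⟩, hm⟩ := csInf_mem hne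
  have hdm : d = (m : ℕ∞) := hMd.symm.trans hm.symm
  rw [hdm, Nat.cast_lt] at hlt
  obtain ⟨r, rfl⟩ := Nat.exists_eq_add_of_lt hlt
  have hMm := (isNthSyzygyOf_hasProjectiveDimensionLT_iff hN 0).2
    (projective_iff_hasProjectiveDimensionLT_one.1 hNproj)
  obtain ⟨K, hK⟩ := exists_isNthSyzygyOf_of_le (r := r) (by omega) hN
  obtain ⟨K', hK'⟩ := exists_isNthSyzygyOf_of_le (r := n + r) (by omega) hN
  have hKn := h K (isNthSyzygyOf_finite hM hK)
    ((isNthSyzygyOf_hasProjectiveDimensionLT_iff hK (n + 1)).1 (by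
      rwa [show r + (n + 1) + 1 = n + r + 1 + 0 + 1 by omega]))
  have hMn := (isNthSyzygyOf_hasProjectiveDimensionLT_iff hK n).2 hKn
  have hK'proj := projective_iff_hasProjectiveDimensionLT_one.2
    ((isNthSyzygyOf_hasProjectiveDimensionLT_iff hK' 0).1 (by
      rwa [show n + r + 0 + 1 = r + n + 1 by omega]))
  have hle : projDim A M ≤ ((n + r : ℕ) : ℕ∞) := sInf_le ⟨n + r, ⟨K', hK', hK'proj⟩, rfl⟩
  rw [hMd, hdm, Nat.cast_le] at hle
  omega

lemma le_finDim {n : ℕ} {N M : ModuleCat.{0} A} (hM : Module.Finite A M)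
    (hN : IsNthSyzygyOf A n N M) (hproj : Module.Projective A N)
    (h : ¬ HasProjectiveDimensionLT M n) : (n : ℕ∞) ≤ finDim A := by
  refine le_sSup ⟨ENat.natCast_ne_top n, M, hM, le_antisymm (sInf_le ⟨n, ⟨N, hN, hproj⟩, rfl⟩) ?_⟩
  refine le_sInf ?_
  rintro _ ⟨m, ⟨N', hN', hproj'⟩, rfl⟩
  simp only [Nat.cast_le]
  by_contra! hlt
  have := (isNthSyzygyOf_hasProjectiveDimensionLT_iff hN' 0).2
    (projective_iff_hasProjectiveDimensionLT_one.1 hproj')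
  exact h (hasProjectiveDimensionLT_of_ge M (m + 0 + 1) n (by omega))

lemma forall_finite_of_indecomposable [IsArtinianRing A] (n : ℕ)
    (h : ∀ M : ModuleCat.{0} A, Module.Finite A M → IndecomposableModule A M →
      HasProjectiveDimensionLT M (n + 2) → HasProjectiveDimensionLT M (n + 1))
    (M : ModuleCat.{0} A) (hM : Module.Finite A M) (hpd : HasProjectiveDimensionLT M (n + 2)) :
    HasProjectiveDimensionLT M (n + 1) := by
  induction hl : Module.length A M using WellFoundedLT.induction generalizing M with
  | _ l ih =>
    subst hl
    by_cases hind : IndecomposableModule A M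
    · exact h M hM hind hpd
    rcases subsingleton_or_nontrivial M with hs | hnt
    · have : HasProjectiveDimensionLT M 0 :=
        (ModuleCat.isZero_of_subsingleton M).hasProjectiveDimensionLT_zero
      exact hasProjectiveDimensionLT_of_ge M 0 (n + 1) (by omega)
    obtain ⟨N, N', hc, hbot, htop⟩ : ∃ N N' : Submodule A M, IsCompl N N' ∧ N ≠ ⊥ ∧ N ≠ ⊤ := by
      by_contra! hcon
      refine hind ⟨hnt, fun N N' hc => ?_⟩
      by_contra! hh
      exact hh.2 (hcon N N' hc hh.1)
    have htop' : N' ≠ ⊤ := by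
      rintro rfl
      exact hbot (by simpa using hc.inf_eq_bot)
    let i : M ≅ ModuleCat.of A N ⊞ ModuleCat.of A N' :=
      (Submodule.prodEquivOfIsCompl N N' hc).symm.toModuleIso ≪≫
        (ModuleCat.biprodIsoProd (ModuleCat.of A N) (ModuleCat.of A N')).symm
    have hsum := hasProjectiveDimensionLT_of_iso i (n + 2)
    have h1 : HasProjectiveDimensionLT (ModuleCat.of A N) (n + 2) :=
      Retract.hasProjectiveDimensionLT
        (Y := ModuleCat.of A N ⊞ ModuleCat.of A N') ⟨Limits.biprod.inl, Limits.biprod.fst, by simp⟩ _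
    have h2 : HasProjectiveDimensionLT (ModuleCat.of A N') (n + 2) :=
      Retract.hasProjectiveDimensionLT
        (Y := ModuleCat.of A N ⊞ ModuleCat.of A N') ⟨Limits.biprod.inr, Limits.biprod.snd, by simp⟩ _
    have h1' := ih _ (Submodule.length_lt htop) (ModuleCat.of A N)
      (inferInstanceAs (Module.Finite A N)) h1 rfl
    have h2' := ih _ (Submodule.length_lt htop') (ModuleCat.of A N')
      (inferInstanceAs (Module.Finite A N')) h2 rfl
    exact hasProjectiveDimensionLT_of_iso i.symm (n + 1)

end HomologicalDimension

section Resolution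

open MulOpposite CategoryTheory

variable {A : Type} [Ring A] {ι : Type}

lemma pathProd_op {e y : ι → A} {σ : Equiv.Perm ι} (hy : ∀ i, e (σ i) * y i = y i)
    (hy' : ∀ i, y i * e i = y i) (k : ℕ) (i : ι) :
    pathProd (fun i => op (e i)) (fun i => op (y (σ⁻¹ i))) σ⁻¹ k i =
      op (pathProd e y σ k ((σ⁻¹ ^ k) i)) := by
  induction k generalizing i with
  | zero => rfl
  | succ k ih =>
    rw [pathProd, ih, pathProd_succ' hy hy', ← op_mul, pow_succ, Equiv.Perm.mul_apply,
      ← Equiv.Perm.mul_apply (σ ^ k), inv_pow, mul_inv_cancel, Equiv.Perm.one_apply]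

namespace SerialDatum

/-- The datum of the opposite ring, with all arrows reversed. -/
def op (D : SerialDatum A ι) : SerialDatum Aᵐᵒᵖ ι where
  e i := MulOpposite.op (D.e i)
  y i := MulOpposite.op (D.y (D.σ⁻¹ i))
  σ := D.σ⁻¹
  e_mul_e i := by rw [← op_mul, D.e_mul_e]
  e_mul_y i := by rw [← op_mul, D.y_mul_e]
  y_mul_e i := by
    have := D.e_mul_y (D.σ⁻¹ i)
    rw [perm_apply_inv] at this
    rw [← op_mul, this]
  y_ne_zero i := op_ne_zero_iff _ |>.2 (D.y_ne_zero _)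
  y_not_left i := by
    rintro ⟨a, ha⟩
    refine D.y_not_right (D.σ⁻¹ i) ⟨a.unop, ?_⟩
    rw [perm_apply_inv]
    exact congrArg unop ha
  y_not_right i := by
    rintro ⟨a, ha⟩
    exact D.y_not_left (D.σ⁻¹ i) ⟨a.unop, congrArg unop ha⟩
  left_max i x hx := by
    have h := D.right_max (D.σ⁻¹ i) x.unop
    rw [perm_apply_inv] at h
    refine (h (congrArg unop hx)).imp ?_ ?_
    · rintro ⟨a, ha⟩
      exact ⟨MulOpposite.op a, congrArg MulOpposite.op ha⟩
    · rintro ⟨a, ha⟩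
      exact ⟨MulOpposite.op a, congrArg MulOpposite.op ha⟩
  right_max i x hx := by
    refine (D.left_max (D.σ⁻¹ i) x.unop (congrArg unop hx)).imp ?_ ?_
    · rintro ⟨a, ha⟩
      exact ⟨MulOpposite.op a, congrArg MulOpposite.op ha⟩
    · rintro ⟨a, ha⟩
      exact ⟨MulOpposite.op a, congrArg MulOpposite.op ha⟩
  generates := D.generates.op
  nilpotent := by
    obtain ⟨n, hn⟩ := D.nilpotent
    exact ⟨n, fun i => by rw [pathProd_op D.e_mul_y D.y_mul_e, hn, op_zero]⟩

variable (D : SerialDatum A ι)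

/-- The path of length `k` which starts at `i`. -/
def path (k : ℕ) (i : ι) : A := pathProd D.e D.y D.σ k i

lemma path_succ (k : ℕ) (i : ι) : D.path (k + 1) i = D.y ((D.σ ^ k) i) * D.path k i :=
  pathProd_succ' D.e_mul_y D.y_mul_e k i

lemma e_mul_path (k : ℕ) (i : ι) : D.e ((D.σ ^ k) i) * D.path k i = D.path k i :=
  idem_mul_pathProd D.e_mul_e k i

lemma path_add (m k : ℕ) (i : ι) :
    D.path (m + k) i = D.path m ((D.σ ^ k) i) * D.path k i := by
  induction m with
  | zero => rw [zero_add]; exact (D.e_mul_path k i).symm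
  | succ m ih =>
    rw [add_right_comm, path_succ, ih, path_succ, mul_assoc, pow_add, Equiv.Perm.mul_apply]

lemma exists_path_eq_zero (i : ι) : ∃ n, D.path n i = 0 :=
  D.nilpotent.imp fun _ hn => hn i

/-- The length of the projective module `A e i`. -/
def len (i : ι) : ℕ := Nat.find (D.exists_path_eq_zero i)

lemma len_le_iff {k : ℕ} {i : ι} : D.len i ≤ k ↔ D.path k i = 0 := by
  constructor
  · intro h
    obtain ⟨m, rfl⟩ := Nat.exists_eq_add_of_le' h
    rw [path_add]
    have : D.path (D.len i) i = 0 := Nat.find_spec (D.exists_path_eq_zero i)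
    rw [this, mul_zero]
  · exact fun h => Nat.find_min' _ h

lemma lt_len_iff {k : ℕ} {i : ι} : k < D.len i ↔ D.path k i ≠ 0 := by
  rw [← not_le, len_le_iff]

lemma one_lt_len (i : ι) : 1 < D.len i := by
  rw [lt_len_iff]
  have : D.path 1 i = D.y i := D.e_mul_y i
  rw [this]
  exact D.y_ne_zero i

lemma len_le_len_add_one (i : ι) : D.len i ≤ D.len (D.σ i) + 1 := by
  rw [len_le_iff, path_add, pow_one, D.len_le_iff.1 le_rfl, zero_mul]

lemma lt_len_iff_lt_len_op (i : ι) (k : ℕ) :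
    k < D.len i ↔ k < D.op.len ((D.σ ^ k) i) := by
  rw [lt_len_iff, lt_len_iff]
  have : D.op.path k ((D.σ ^ k) i) = MulOpposite.op (D.path k i) := by
    refine (pathProd_op D.e_mul_y D.y_mul_e k _).trans ?_
    rw [← Equiv.Perm.mul_apply, inv_pow, inv_mul_cancel, Equiv.Perm.one_apply]
    rfl
  rw [this, op_ne_zero_iff]

/-- The submodule of `A e i` generated by the path of length `k`. -/
def sub (k : ℕ) (i : ι) : Submodule A A := Submodule.span A {D.path k i}

lemma mem_sub {k : ℕ} {i : ι} {x : A} : x ∈ D.sub k i ↔ ∃ a, a * D.path k i = x :=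
  Submodule.mem_span_singleton

lemma path_mem_sub (k : ℕ) (i : ι) : D.path k i ∈ D.sub k i :=
  Submodule.mem_span_singleton_self _

lemma e_mem_sub_zero (i : ι) : D.e i ∈ D.sub 0 i := D.path_mem_sub 0 i

lemma mem_sub_zero {i : ι} {x : A} : x ∈ D.sub 0 i ↔ x * D.e i = x :=
  mem_span_idem_iff (D.e_mul_e i)

lemma sub_le_iff {k : ℕ} {i : ι} {N : Submodule A A} : D.sub k i ≤ N ↔ D.path k i ∈ N := by
  rw [sub, Submodule.span_le, Set.singleton_subset_iff, SetLike.mem_coe]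

lemma sub_antitone (i : ι) : Antitone fun k => D.sub k i := by
  refine antitone_nat_of_succ_le fun k => ?_
  rw [sub_le_iff, mem_sub, path_succ]
  exact ⟨_, rfl⟩

lemma sub_eq_bot_iff {k : ℕ} {i : ι} : D.sub k i = ⊥ ↔ D.len i ≤ k := by
  rw [len_le_iff, sub, Submodule.span_singleton_eq_bot]

lemma sub_le_of_mem {k : ℕ} {i : ι} {N : Submodule A A} {x : A} (hx : x ∈ N)
    (hk : x ∈ D.sub k i) (hk' : x ∉ D.sub (k + 1) i) : D.sub k i ≤ N := by
  obtain ⟨a, rfl⟩ := D.mem_sub.1 hk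
  rw [sub_le_iff]
  rcases D.left_max ((D.σ ^ k) i) (a * D.e _) (by rw [mul_assoc, D.e_mul_e]) with
    ⟨b, hb⟩ | ⟨b, hb⟩
  · have := N.smul_mem b hx
    rwa [smul_eq_mul, ← D.e_mul_path, ← mul_assoc a, ← mul_assoc b, hb, e_mul_path] at this
  · refine absurd (D.mem_sub.2 ⟨b, ?_⟩) hk'
    rw [path_succ, ← mul_assoc, ← hb, mul_assoc, e_mul_path]

lemma exists_eq_sub {i : ι} {N : Submodule A A} (hN : N ≤ D.sub 0 i) :
    ∃ k ≤ D.len i, N = D.sub k i := by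
  by_cases h : ∃ k, k ≤ D.len i ∧ ¬ N ≤ D.sub k i
  · obtain ⟨hle, hspec⟩ := Nat.find_spec h
    have hmin := fun m => Nat.find_min h (m := m)
    generalize Nat.find h = k at hle hspec hmin
    obtain _ | k := k
    · exact absurd hN hspec
    have hk : N ≤ D.sub k i := by
      by_contra hcon
      exact hmin k k.lt_succ_self ⟨by omega, hcon⟩
    obtain ⟨x, hx, hx'⟩ := SetLike.not_le_iff_exists.1 hspec
    exact ⟨k, by omega, le_antisymm hk (D.sub_le_of_mem hx (hk hx) hx')⟩
  · push Not at h
    refine ⟨_, le_rfl, le_antisymm (h _ le_rfl) ?_⟩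
    rw [D.sub_eq_bot_iff.2 le_rfl]
    exact bot_le

lemma exists_eq_mul_y {i : ι} {N : Submodule A (D.sub 0 i)} (hN : N ≠ ⊤) {x : D.sub 0 i}
    (hx : x ∈ N) : ∃ a, (x : A) = a * D.y i := by
  refine (D.left_max i x (D.mem_sub_zero.1 x.2)).resolve_left ?_
  rintro ⟨a, ha⟩
  refine hN (Submodule.eq_top_iff'.2 fun z => ?_)
  have : z = ((z : A) * a) • x := by
    ext
    rw [Submodule.coe_smul, smul_eq_mul, mul_assoc, ha, D.mem_sub_zero.1 z.2]
  rw [this]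
  exact N.smul_mem _ hx

lemma isSmallSubmodule {i : ι} {N : Submodule A (D.sub 0 i)} (hN : N ≠ ⊤) :
    IsSmallSubmodule A N := by
  intro K hK
  by_contra hKtop
  obtain ⟨n, hn, k, hk, hnk⟩ := Submodule.mem_sup.1
    (hK ▸ Submodule.mem_top : (⟨D.e i, D.e_mem_sub_zero i⟩ : D.sub 0 i) ∈ N ⊔ K)
  obtain ⟨a, ha⟩ := D.exists_eq_mul_y hN hn
  obtain ⟨b, hb⟩ := D.exists_eq_mul_y hKtop hk
  refine D.y_not_left i ⟨a + b, ?_⟩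
  rw [add_mul, ← ha, ← hb]
  exact congrArg Subtype.val hnk

/-- A nonzero module generated by an element `m = e i • m` whose annihilator in `A e i` is
generated by a path has that submodule of `A e i` as its syzygy. -/
lemma isSyzygyOf_of_generator {M : ModuleCat.{0} A} {i : ι} {m : M} (hem : D.e i • m = m)
    (hm : m ≠ 0) (hgen : ∀ z : M, ∃ a : A, z = a • m) {k : ℕ}
    (hk : ∀ x ∈ D.sub 0 i, x • m = 0 ↔ x ∈ D.sub k i) :
    IsSyzygyOf A (ModuleCat.of A (D.sub k i)) M := by
  let f : D.sub 0 i →ₗ[A] M := (LinearMap.toSpanSingleton A M m).comp (D.sub 0 i).subtype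
  have hker : (LinearMap.ker f).map (D.sub 0 i).subtype = D.sub k i := by
    ext x
    constructor
    · rintro ⟨z, hz, rfl⟩
      exact (hk z z.2).1 hz
    · intro hx
      have hx0 := D.sub_antitone i (Nat.zero_le k) hx
      exact ⟨⟨x, hx0⟩, (hk x hx0).2 hx, rfl⟩
  refine ⟨ModuleCat.of A (D.sub 0 i), f, projective_span_idem (D.e_mul_e i),
    Module.Finite.span_singleton A (D.path 0 i), fun z => ?_, D.isSmallSubmodule fun htop => ?_,
    ⟨(LinearEquiv.ofEq _ _ hker.symm).trans
      (Submodule.equivSubtypeMap (D.sub 0 i) (LinearMap.ker f)).symm⟩⟩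
  · obtain ⟨a, rfl⟩ := hgen z
    refine ⟨⟨a * D.e i, D.mem_sub_zero.2 (by rw [mul_assoc, D.e_mul_e])⟩, ?_⟩
    change (a * D.e i) • m = a • m
    rw [mul_smul, hem]
  · have : f ⟨D.e i, D.e_mem_sub_zero i⟩ = 0 := LinearMap.mem_ker.1 (htop ▸ Submodule.mem_top)
    exact hm (hem.symm.trans this)

lemma exists_annihilator_eq_sub {M : Type} [AddCommGroup M] [Module A M] (i : ι) (m : M) :
    ∃ k ≤ D.len i, ∀ x ∈ D.sub 0 i, x • m = 0 ↔ x ∈ D.sub k i := by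
  obtain ⟨k, hk, h⟩ := D.exists_eq_sub (i := i)
    (N := D.sub 0 i ⊓ LinearMap.ker (LinearMap.toSpanSingleton A M m)) inf_le_left
  refine ⟨k, hk, fun x hx => ?_⟩
  rw [← h, Submodule.mem_inf]
  exact ⟨fun h => ⟨hx, h⟩, fun h => h.2⟩

lemma isSyzygyOf_sub {k : ℕ} {i : ι} (hk : k < D.len i) :
    IsSyzygyOf A (ModuleCat.of A (D.sub (D.len i - k) ((D.σ ^ k) i)))
      (ModuleCat.of A (D.sub k i)) := by
  let g : ModuleCat.of A (D.sub k i) := ⟨D.path k i, D.path_mem_sub k i⟩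
  have hg : ∀ a : A, a • g = 0 ↔ a * D.path k i = 0 := fun a => Subtype.ext_iff
  refine D.isSyzygyOf_of_generator (m := g) (Subtype.ext (D.e_mul_path k i))
    (fun h => D.lt_len_iff.1 hk (congrArg Subtype.val h)) (fun z => ?_) ?_
  · obtain ⟨a, ha⟩ := D.mem_sub.1 z.2
    exact ⟨a, Subtype.ext ha.symm⟩
  obtain ⟨m, -, hm⟩ := D.exists_annihilator_eq_sub ((D.σ ^ k) i) g
  have hzero : ∀ l, D.path l ((D.σ ^ k) i) ∈ D.sub m ((D.σ ^ k) i) ↔ D.len i ≤ l + k := by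
    intro l
    rw [← hm _ (D.sub_antitone _ (Nat.zero_le l) (D.path_mem_sub l _)), hg, ← path_add, len_le_iff]
  have h1 := (hzero m).1 (D.path_mem_sub _ _)
  have h2 := D.sub_le_iff.2 ((hzero (D.len i - k)).2 (by omega))
  have h3 : D.len i - k ≤ m := by omega
  rwa [le_antisymm h2 (D.sub_antitone _ h3)]

lemma projective_sub_iff {k : ℕ} {i : ι} (hk : k < D.len i) :
    Module.Projective A (D.sub k i) ↔ D.len ((D.σ ^ k) i) ≤ D.len i - k := by
  rw [← sub_eq_bot_iff, ← Submodule.subsingleton_iff_eq_bot]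
  exact isSyzygyOf_projective_iff (D.isSyzygyOf_sub hk)

lemma exists_isSyzygyOf [IsNoetherianRing A] {M : ModuleCat.{0} A} [Module.Finite A M]
    [Nontrivial M] (hM : IsUniserialModule A M) :
    ∃ i k, 0 < k ∧ k ≤ D.len i ∧ IsSyzygyOf A (ModuleCat.of A (D.sub k i)) M := by
  have hchain := isChainModule_of_isUniserial hM
  obtain ⟨x, hx⟩ := hchain.exists_generator
  have hx0 : x ≠ 0 := by
    rintro rfl
    obtain ⟨z, hz⟩ := exists_ne (0 : M)
    obtain ⟨a, ha⟩ := hx z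
    exact hz (ha.trans (smul_zero a))
  obtain ⟨i, m, hm⟩ := hchain.exists_idem_generator D.generates hx0 hx
  have hem : D.e i • D.e i • m = D.e i • m := by rw [← mul_smul, D.e_mul_e]
  have hm0 : D.e i • m ≠ 0 := by
    intro h
    obtain ⟨a, ha⟩ := hm x
    exact hx0 (by rw [ha, h, smul_zero])
  obtain ⟨k, hk, hann⟩ := D.exists_annihilator_eq_sub i (D.e i • m)
  refine ⟨i, k, Nat.pos_of_ne_zero ?_, hk, D.isSyzygyOf_of_generator hem hm0 hm hann⟩
  rintro rfl
  exact hm0 (hem.symm.trans ((hann _ (D.e_mem_sub_zero i)).2 (D.e_mem_sub_zero i)))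

lemma exists_module_isSyzygyOf {k : ℕ} (hk : 0 < k) (i : ι) :
    ∃ M : ModuleCat.{0} A, Module.Finite A M ∧
      IsSyzygyOf A (ModuleCat.of A (D.sub k i)) M := by
  let Q := D.sub 0 i ⧸ (D.sub k i).comap (D.sub 0 i).subtype
  have hfin : Module.Finite A (D.sub 0 i) := Module.Finite.span_singleton A (D.path 0 i)
  let m : D.sub 0 i := ⟨D.e i, D.e_mem_sub_zero i⟩
  let q : ModuleCat.of A Q := Submodule.Quotient.mk m
  have hann : ∀ x ∈ D.sub 0 i, x • q = 0 ↔ x ∈ D.sub k i := by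
    intro x hx
    change Submodule.Quotient.mk (x • m) = (0 : Q) ↔ _
    rw [Submodule.Quotient.mk_eq_zero, Submodule.mem_comap]
    change x * D.e i ∈ _ ↔ _
    rw [D.mem_sub_zero.1 hx]
  have hem : D.e i • m = m := Subtype.ext (D.e_mul_e i)
  refine ⟨ModuleCat.of A Q, inferInstanceAs (Module.Finite A Q),
    D.isSyzygyOf_of_generator (m := q) (congrArg Submodule.Quotient.mk hem) (fun h => ?_)
      (fun z => ?_) hann⟩
  · have h1 : D.e i • q = 0 := by rw [h, smul_zero]
    obtain ⟨a, ha⟩ := D.mem_sub.1 (D.sub_antitone i hk ((hann _ (D.e_mem_sub_zero i)).1 h1))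
    have hy : D.path 1 i = D.y i := D.e_mul_y i
    exact D.y_not_left i ⟨a, hy ▸ ha⟩
  · obtain ⟨z, rfl⟩ := Submodule.Quotient.mk_surjective _ z
    refine ⟨z, congrArg Submodule.Quotient.mk (Subtype.ext ?_)⟩
    exact (D.mem_sub_zero.1 z.2).symm

lemma finDim_le_zero [IsNoetherianRing A] (hA : IsNakayamaRing A)
    (h : ∀ i, D.len i ≤ D.len (D.σ i)) : finDim A ≤ 0 := by
  have := hA.1
  have hmono : ∀ k i, D.len i ≤ D.len ((D.σ ^ k) i) := by
    intro k i
    induction k with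
    | zero => rfl
    | succ k ih => exact ih.trans (by rw [pow_succ', Equiv.Perm.mul_apply]; exact h _)
  refine finDim_le 0 (forall_finite_of_indecomposable 0 fun M hM hind hpd => ?_)
  have := hind.1
  obtain ⟨i, k, hk, hki, hsyz⟩ := D.exists_isSyzygyOf (hA.2 M hM hind)
  rw [isSyzygyOf_hasProjectiveDimensionLT_iff hsyz,
    ← projective_iff_hasProjectiveDimensionLT_one] at hpd
  rw [← projective_iff_hasProjectiveDimensionLT_one, isSyzygyOf_projective_iff hsyz]
  refine Submodule.subsingleton_iff_eq_bot.2 (D.sub_eq_bot_iff.2 ?_)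
  by_contra! hlt
  have := (D.projective_sub_iff hlt).1 hpd
  have := hmono k i
  omega

lemma finDim_le_one [IsNoetherianRing A] (hA : IsNakayamaRing A)
    (h : ∀ i, D.len (D.σ⁻¹ ((D.σ ^ D.len i) i)) ≤ D.len ((D.σ ^ D.len i) i)) :
    finDim A ≤ 1 := by
  have := hA.1
  refine finDim_le 1 (forall_finite_of_indecomposable 1 fun M hM hind hpd => ?_)
  have := hind.1
  obtain ⟨i, k, hk, hki, hsyz⟩ := D.exists_isSyzygyOf (hA.2 M hM hind)
  rw [isSyzygyOf_hasProjectiveDimensionLT_iff hsyz] at hpd ⊢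
  rw [← projective_iff_hasProjectiveDimensionLT_one]
  rcases hki.eq_or_lt with rfl | hlt
  · have := Submodule.subsingleton_iff_eq_bot.2 (D.sub_eq_bot_iff.2 (le_refl (D.len i)))
    exact inferInstanceAs (Module.Projective A (D.sub (D.len i) i))
  rw [isSyzygyOf_hasProjectiveDimensionLT_iff (D.isSyzygyOf_sub hlt),
    ← projective_iff_hasProjectiveDimensionLT_one] at hpd
  refine (D.projective_sub_iff hlt).2 ?_
  by_contra! hlt'
  obtain ⟨m, hm⟩ : ∃ m, D.len i - k = m + 1 := ⟨D.len i - k - 1, by omega⟩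
  have hproj := (D.projective_sub_iff hlt').1 hpd
  have hi := h i
  rw [show D.len i = m + 1 + k by omega, pow_add, Equiv.Perm.mul_apply] at hi
  rw [hm] at hproj hlt'
  generalize (D.σ ^ k) i = j at *
  have hle := le_iterate_add D.len_le_len_add_one m j
  rw [pow_succ', Equiv.Perm.mul_apply] at hi hproj
  rw [perm_inv_apply] at hi
  omega

lemma one_le_finDim {i : ι} (h : D.len (D.σ i) < D.len i) : 1 ≤ finDim A := by
  obtain ⟨M, hM, hsyz⟩ := D.exists_module_isSyzygyOf one_pos i
  have hi := D.one_lt_len i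
  have := le_finDim (n := 1) hM ⟨M, ⟨LinearEquiv.refl A M⟩, hsyz⟩
    ((D.projective_sub_iff hi).2 (by rw [pow_one]; omega)) fun hpd => by
      rw [← projective_iff_hasProjectiveDimensionLT_one, isSyzygyOf_projective_iff hsyz] at hpd
      exact hi.not_ge (D.sub_eq_bot_iff.1 (Submodule.subsingleton_iff_eq_bot.1 hpd))
  exact_mod_cast this

lemma two_le_finDim {i : ι}
    (h : D.len ((D.σ ^ D.len i) i) < D.len (D.σ⁻¹ ((D.σ ^ D.len i) i))) : 2 ≤ finDim A := by
  have hi := D.one_lt_len i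
  obtain ⟨k, hk⟩ : ∃ k, D.len i = k + 1 := ⟨D.len i - 1, by omega⟩
  rw [hk, pow_succ', Equiv.Perm.mul_apply, perm_inv_apply] at h
  obtain ⟨M, hM, hsyz⟩ := D.exists_module_isSyzygyOf (k := k) (by omega) i
  have hlt : k < D.len i := by omega
  have hsyz' := D.isSyzygyOf_sub hlt
  have hj := D.one_lt_len ((D.σ ^ k) i)
  have hki : D.len i - k = 1 := by omega
  rw [hki] at hsyz'
  have := le_finDim (n := 2) hM ⟨_, ⟨M, ⟨LinearEquiv.refl A M⟩, hsyz⟩, hsyz'⟩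
    ((D.projective_sub_iff hj).2 (by rw [pow_one]; omega)) fun hpd => by
      rw [isSyzygyOf_hasProjectiveDimensionLT_iff hsyz,
        ← projective_iff_hasProjectiveDimensionLT_one] at hpd
      have := (D.projective_sub_iff hlt).1 hpd
      omega
  exact_mod_cast this

theorem finDim_eq_one_iff (hA : IsNakayamaRing A) :
    finDim A = 1 ↔ DropsAwayFromTargets D.σ D.len := by
  have := hA.1
  constructor
  · intro h
    constructor
    · intro i
      by_contra! hlt
      have := D.two_le_finDim hlt
      rw [h] at this
      exact absurd this (by decide)
    · by_contra! hcon
      have := D.finDim_le_zero hA hcon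
      rw [h] at this
      exact absurd this (by decide)
  · rintro ⟨htarget, i, hi⟩
    exact le_antisymm (D.finDim_le_one hA htarget) (D.one_le_finDim hi)

end SerialDatum

end Resolution

end CyclicNakayama

/-- For a cyclic Nakayama algebra `Λ`, `findim Λ = 1` iff
`findim Λᵒᵖ = 1`. -/
theorem findim_one_iff_findim_op_one
    (A : Type) [Ring A] (hA : IsCyclicNakayama A) :
    finDim A = 1 ↔ finDim Aᵐᵒᵖ = 1 := by
  obtain ⟨ι, _, ⟨D⟩⟩ := CyclicNakayama.exists_serialDatum hA
  rw [D.finDim_eq_one_iff hA.1.1, D.op.finDim_eq_one_iff hA.1.2]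
  exact CyclicNakayama.dropsAwayFromTargets_inv D.len_le_len_add_one D.op.len_le_len_add_one
    (fun i => zero_lt_one.trans (D.one_lt_len i)) (fun i => zero_lt_one.trans (D.op.one_lt_len i))
    D.lt_len_iff_lt_len_op

end
end

section
/- For a cyclic Nakayama algebra Λ, findim Λ = 2 if and only if findim Λ^op = 2. -/
open Function DirectSum
open scoped Classical

noncomputable section

/-- A map commuting with translation by `N` commutes with translation by the
multiples of `N`. -/
theorem translation_zmul {N : ℕ} {f : ℤ → ℤ} (hf : ∀ i, f (i + N) = f i + N) (i k : ℤ) :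
    f (i + k * N) = f i + k * N := by
  induction k using Int.induction_on with
  | zero => simp
  | succ k ih =>
    rw [show i + ((k : ℤ) + 1) * N = (i + k * N) + N by ring, hf, ih]; ring
  | pred k ih =>
    have := hf (i + (-(k : ℤ) - 1) * N)
    rw [show i + (-(k : ℤ) - 1) * N + N = i + -(k : ℤ) * N by ring, ih] at this
    linarith

/-- A map commuting with translation by `N` induces a map on `ZMod N`. -/
theorem exists_zmod_lift {N : ℕ} [NeZero N] {f : ℤ → ℤ} (hf : ∀ i, f (i + N) = f i + N) :
    ∃ F : ZMod N → ZMod N, ∀ i : ℤ, F (i : ZMod N) = (f i : ZMod N) := by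
  refine ⟨fun x => (f (x.val : ℤ) : ZMod N), fun i => ?_⟩
  have h1 : (((i : ZMod N).val : ℤ) : ZMod N) = (i : ZMod N) := by simp
  rw [ZMod.intCast_eq_intCast_iff_dvd_sub] at h1
  obtain ⟨k, hk⟩ := h1
  have : i = ((i : ZMod N).val : ℤ) + k * N := by linarith
  conv_rhs => rw [this, translation_zmul hf]
  simp

/-- A periodic self-map of `ℤ` that is injective on a periodic set which it preserves is
surjective on it. -/
theorem periodic_surjOn_of_injOn {N : ℕ} [NeZero N] {h : ℤ → ℤ} {s : Set ℤ}
    (hh : ∀ i, h (i + N) = h i + N) (hs : ∀ (i k : ℤ), i ∈ s → i + k * N ∈ s)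
    (hmaps : Set.MapsTo h s s) (hinj : Set.InjOn h s) : Set.SurjOn h s s := by
  obtain ⟨H, hH⟩ := exists_zmod_lift hh
  let t : Set (ZMod N) := (fun i : ℤ => (i : ZMod N)) '' s
  have ht : Set.MapsTo H t t := by
    rintro _ ⟨i, hi, rfl⟩
    exact ⟨h i, hmaps hi, (hH i).symm⟩
  have hti : Set.InjOn H t := by
    rintro _ ⟨i, hi, rfl⟩ _ ⟨j, hj, rfl⟩ e
    simp only [hH] at e
    rw [ZMod.intCast_eq_intCast_iff_dvd_sub] at e
    obtain ⟨k, hk⟩ := e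
    have : h (i + k * N) = h j := by rw [translation_zmul hh]; linarith
    have := hinj (hs i k hi) hj this
    rw [← this]; simp
  have hsurj : Set.SurjOn H t t :=
    ((Set.toFinite t).surjOn_iff_bijOn_of_mapsTo ht).2 
      ((Set.toFinite t).injOn_iff_bijOn_of_mapsTo ht |>.1 hti)
  intro j hj
  obtain ⟨_, ⟨i, hi, rfl⟩, e⟩ := hsurj ⟨j, hj, rfl⟩
  simp only [hH] at e
  rw [ZMod.intCast_eq_intCast_iff_dvd_sub] at e
  obtain ⟨k, hk⟩ := e
  exact ⟨i + k * N, hs i k hi, by rw [translation_zmul hh]; linarith⟩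

section Galois

variable {N : ℕ} [NeZero N] {f g : ℤ → ℤ}

theorem right_adjoint_injOn_range (gc : GaloisConnection f g)
    (hf : ∀ i, f (i + N) = f i + N) (h : ∀ i j, f (f i) = f (f j) → f i = f j) (a b : ℤ)
    (hab : g (g a) = g (g b)) : g a = g b := by
  have hsurj : Set.SurjOn f (Set.range f) (Set.range f) := by
    apply periodic_surjOn_of_injOn hf
    · rintro _ k ⟨i, rfl⟩
      exact ⟨i + k * N, translation_zmul hf i k⟩
    · rintro _ ⟨i, rfl⟩; exact ⟨f i, rfl⟩
    · rintro _ ⟨i, rfl⟩ _ ⟨j, rfl⟩ e; exact h i j e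
  refine eq_of_forall_le_iff fun i => ?_
  obtain ⟨_, ⟨k, rfl⟩, hk⟩ := hsurj ⟨i, rfl⟩
  rw [← gc, ← gc, ← hk, gc, gc, gc, gc, hab]

theorem right_adjoint_separates (gc : GaloisConnection f g)
    (hf : ∀ i, f (i + N) = f i + N) (hg : ∀ i, g (i + N) = g i + N)
    (h : ∀ i, f (f i - 1) ≠ f (f i)) (j : ℤ) : g (g j + 1) ≠ g (g j) := by
  have hmem : ∀ i, g (f (f i) - 1) = f i - 1 := by
    intro i
    apply le_antisymm
    · by_contra! hlt
      have : f i ≤ g (f (f i) - 1) := by omega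
      rw [← gc] at this; omega
    · rw [← gc]
      have := lt_of_le_of_ne (gc.monotone_l (show f i - 1 ≤ f i by omega)) (h i)
      omega
  have hsurj : Set.SurjOn (fun x => f x - 1) (Set.range g) (Set.range g) := by
    apply periodic_surjOn_of_injOn (N := N)
    · intro i; rw [hf]; ring
    · rintro _ k ⟨i, rfl⟩
      exact ⟨i + k * N, translation_zmul hg i k⟩
    · rintro _ ⟨i, rfl⟩; exact ⟨_, hmem _⟩
    · rintro _ ⟨i, rfl⟩ _ ⟨j, rfl⟩ e
      simp only [sub_left_inj] at e
      rw [← gc.u_l_u_eq_u i, e, gc.u_l_u_eq_u]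
  obtain ⟨i, -, hi⟩ := hsurj ⟨j, rfl⟩
  simp only at hi
  rw [← hi, sub_add_cancel]
  intro e
  have h1 : i ≤ g (f i) := gc.le_u_l i
  rw [e, ← gc] at h1
  omega

end Galois

section Pairs

variable {V : Type} (ν : Equiv.Perm V) (c : V → ℕ)

/-- The effect of the syzygy functor on the uniserial module with top `p.1` and length `p.2`. -/
def syzygyPair (p : V × ℕ) : V × ℕ := ((ν ^ p.2) p.1, c p.1 - p.2)

/-- The uniserial module with top `p.1` and length `p.2` is projective. -/
def IsProjectivePair (p : V × ℕ) : Prop := p.2 = 0 ∨ p.2 = c p.1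

/-- No pair has projective dimension exactly `d + 1`. -/
def PairDimLE (d : ℕ) : Prop :=
  ∀ p : V × ℕ, p.2 ≤ c p.1 → IsProjectivePair c ((syzygyPair ν c)^[d + 1] p) →
    IsProjectivePair c ((syzygyPair ν c)^[d] p)

/-- The end point function: the projective module starting at position `i` ends at
`endPoint ν c v i`. -/
def endPoint (v : V) (i : ℤ) : ℤ := i + c ((ν ^ i) v)

/-- The module occupying the positions `i, …, j - 1`. -/
def intervalPair (v : V) (i j : ℤ) : V × ℕ := ((ν ^ i) v, (j - i).toNat)

variable {ν c}

theorem syzygyPair_intervalPair {v : V} {i j : ℤ} (hij : i ≤ j) :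
    syzygyPair ν c (intervalPair ν v i j) = intervalPair ν v j (endPoint ν c v i) := by
  obtain ⟨k, rfl⟩ := Int.le.dest hij
  unfold syzygyPair intervalPair endPoint
  ext1
  · rw [add_sub_cancel_left, Int.toNat_natCast, ← Equiv.Perm.mul_apply, ← zpow_natCast,
      ← zpow_add, add_comm]
  · simp only [add_sub_cancel_left, Int.toNat_natCast]
    omega

theorem isProjectivePair_intervalPair {v : V} {i j : ℤ} (hij : i ≤ j) :
    IsProjectivePair c (intervalPair ν v i j) ↔ j = i ∨ j = endPoint ν c v i := by
  unfold IsProjectivePair intervalPair endPoint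
  simp only
  omega

theorem endPoint_add_orderOf (v : V) (i : ℤ) :
    endPoint ν c v (i + orderOf ν) = endPoint ν c v i + orderOf ν := by
  unfold endPoint
  rw [zpow_add, zpow_natCast, pow_orderOf_eq_one, mul_one]
  ring

theorem lt_endPoint (hc : ∀ v, 2 ≤ c v) (v : V) (i : ℤ) : i + 1 < endPoint ν c v i := by
  have := hc ((ν ^ i) v)
  unfold endPoint
  omega

theorem pairDimLE_iff (d : ℕ) :
    PairDimLE ν c d ↔ ∀ v i j, i ≤ j → j ≤ endPoint ν c v i →
      IsProjectivePair c ((syzygyPair ν c)^[d + 1] (intervalPair ν v i j)) →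
      IsProjectivePair c ((syzygyPair ν c)^[d] (intervalPair ν v i j)) := by
  constructor
  · intro h v i j hij hj
    apply h
    unfold intervalPair endPoint at *
    simp only
    omega
  · intro h p hp
    have := h p.1 0 p.2 (by omega) (by simpa [endPoint] using hp)
    simpa [intervalPair] using this

theorem pairDimLE_one_iff (hc : ∀ v, 2 ≤ c v) (hm : ∀ v, Monotone (endPoint ν c v)) :
    PairDimLE ν c 1 ↔
      ∀ v i, endPoint ν c v (endPoint ν c v i - 1) ≠ endPoint ν c v (endPoint ν c v i) := by
  rw [pairDimLE_iff]
  refine forall_congr' fun v => ?_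
  have key : ∀ i j, i ≤ j → j ≤ endPoint ν c v i →
      ((IsProjectivePair c ((syzygyPair ν c)^[1 + 1] (intervalPair ν v i j)) →
      IsProjectivePair c ((syzygyPair ν c)^[1] (intervalPair ν v i j))) ↔
      (endPoint ν c v j = endPoint ν c v i ∨
        endPoint ν c v j = endPoint ν c v (endPoint ν c v i) →
        endPoint ν c v i = j ∨ endPoint ν c v i = endPoint ν c v j)) := by
    intro i j hij hj
    rw [Function.iterate_succ_apply, Function.iterate_one, syzygyPair_intervalPair hij,
      syzygyPair_intervalPair hj, isProjectivePair_intervalPair hj,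
      isProjectivePair_intervalPair (hm v hij)]
  constructor
  · intro h i e
    have h1 := lt_endPoint (ν := ν) hc v i
    have h2 := lt_endPoint (ν := ν) hc v (endPoint ν c v i)
    have := (key i (endPoint ν c v i - 1) (by omega) (by omega)).1
      (h i _ (by omega) (by omega)) (Or.inr e)
    omega
  · intro h i j hij hj
    rw [key i j hij hj]
    rintro (e | e)
    · exact Or.inr e.symm
    · by_contra! hne
      have h1 := hm v (show j ≤ endPoint ν c v i - 1 by omega)
      have h2 := hm v (show endPoint ν c v i - 1 ≤ endPoint ν c v i by omega)
      have := h i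
      omega

theorem pairDimLE_two_iff (hc : ∀ v, 2 ≤ c v) (hm : ∀ v, Monotone (endPoint ν c v)) :
    PairDimLE ν c 2 ↔
      ∀ v i j, endPoint ν c v (endPoint ν c v i) = endPoint ν c v (endPoint ν c v j) →
        endPoint ν c v i = endPoint ν c v j := by
  rw [pairDimLE_iff]
  refine forall_congr' fun v => ?_
  have key : ∀ i j, i ≤ j → j ≤ endPoint ν c v i →
      ((IsProjectivePair c ((syzygyPair ν c)^[2 + 1] (intervalPair ν v i j)) →
      IsProjectivePair c ((syzygyPair ν c)^[2] (intervalPair ν v i j))) ↔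
      (endPoint ν c v (endPoint ν c v i) = endPoint ν c v j ∨
        endPoint ν c v (endPoint ν c v i) = endPoint ν c v (endPoint ν c v j) →
        endPoint ν c v j = endPoint ν c v i ∨
          endPoint ν c v j = endPoint ν c v (endPoint ν c v i))) := by
    intro i j hij hj
    simp only [Function.iterate_succ_apply, Function.iterate_zero_apply]
    rw [syzygyPair_intervalPair hij,
      syzygyPair_intervalPair hj, syzygyPair_intervalPair (hm v hij),
      isProjectivePair_intervalPair (hm v hij), isProjectivePair_intervalPair (hm v hj)]
  constructor
  · intro h
    have main : ∀ i j, i ≤ j →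
        endPoint ν c v (endPoint ν c v i) = endPoint ν c v (endPoint ν c v j) →
        endPoint ν c v i = endPoint ν c v j := by
      intro i j hij e
      have h2 := lt_endPoint (ν := ν) hc v (endPoint ν c v j)
      by_cases hj : j ≤ endPoint ν c v i
      · have := (key i j hij hj).1 (h i j hij hj) (Or.inr e)
        omega
      · have := hm v (show endPoint ν c v i ≤ j by omega)
        omega
    intro i j e
    rcases le_total i j with hij | hij
    · exact main i j hij e
    · exact (main j i hij e.symm).symm
  · intro h i j hij hj
    rw [key i j hij hj]
    rintro (e | e)
    · exact Or.inr e.symm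
    · exact Or.inl (h i j e).symm

variable {c' : V → ℕ}

theorem galoisConnection_endPoint (hc : ∀ v, 2 ≤ c v) (hc' : ∀ v, 2 ≤ c' v)
    (hcc : ∀ v k, c v ≤ k ↔ c' ((ν ^ k) v) ≤ k) (v : V) :
    GaloisConnection (endPoint ν c v) (fun j => -endPoint ν⁻¹ c' v (-j)) := by
  intro i j
  have h1 := hc ((ν ^ i) v)
  have h2 := hc' ((ν ^ j) v)
  simp only [endPoint, inv_zpow', neg_neg]
  rcases lt_or_ge j i with h | h
  · omega
  · obtain ⟨k, rfl⟩ := Int.le.dest h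
    have := hcc ((ν ^ i) v) k
    rw [← Equiv.Perm.mul_apply, ← zpow_natCast, ← zpow_add, add_comm (k : ℤ)] at this
    omega

theorem galoisConnection_endPoint_neg (hc : ∀ v, 2 ≤ c v) (hc' : ∀ v, 2 ≤ c' v)
    (hcc : ∀ v k, c v ≤ k ↔ c' ((ν ^ k) v) ≤ k) (v : V) :
    GaloisConnection (endPoint ν⁻¹ c' v) (fun j => -endPoint ν c v (-j)) := by
  intro i j
  have := galoisConnection_endPoint hc hc' hcc v (-j) (-i)
  simp only [neg_neg] at this ⊢
  omega

theorem PairDimLE.inv_of_le_two [Finite V] (hc : ∀ v, 2 ≤ c v) (hc' : ∀ v, 2 ≤ c' v)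
    (hcc : ∀ v k, c v ≤ k ↔ c' ((ν ^ k) v) ≤ k) :
    (PairDimLE ν c 1 ↔ PairDimLE ν⁻¹ c' 1) ∧ (PairDimLE ν c 2 ↔ PairDimLE ν⁻¹ c' 2) := by
  have gc := galoisConnection_endPoint hc hc' hcc
  have gc' := galoisConnection_endPoint_neg hc hc' hcc
  have : NeZero (orderOf ν) := ⟨(orderOf_pos ν).ne'⟩
  have per := endPoint_add_orderOf (ν := ν) (c := c)
  have per' : ∀ (v : V) (i : ℤ), endPoint ν⁻¹ c' v (i + orderOf ν) =
      endPoint ν⁻¹ c' v i + orderOf ν := by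
    intro v i
    have := endPoint_add_orderOf (ν := ν⁻¹) (c := c') v i
    rwa [orderOf_inv] at this
  have perneg : ∀ (v : V) (i : ℤ), -endPoint ν c v (-(i + orderOf ν)) =
      -endPoint ν c v (-i) + orderOf ν := by
    intro v i
    have := per v (-(i + orderOf ν))
    rw [show -(i + (orderOf ν : ℤ)) + orderOf ν = -i by ring] at this
    omega
  have perneg' : ∀ (v : V) (i : ℤ), -endPoint ν⁻¹ c' v (-(i + orderOf ν)) =
      -endPoint ν⁻¹ c' v (-i) + orderOf ν := by
    intro v i
    have := per' v (-(i + orderOf ν))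
    rw [show -(i + (orderOf ν : ℤ)) + orderOf ν = -i by ring] at this
    omega
  rw [pairDimLE_one_iff hc fun v => (gc v).monotone_l,
    pairDimLE_one_iff hc' fun v => (gc' v).monotone_l,
    pairDimLE_two_iff hc fun v => (gc v).monotone_l,
    pairDimLE_two_iff hc' fun v => (gc' v).monotone_l]
  refine ⟨forall_congr' fun v => ⟨fun h i e => ?_, fun h i e => ?_⟩,
    forall_congr' fun v => ⟨fun h i j e => ?_, fun h i j e => ?_⟩⟩
  · apply right_adjoint_separates (gc v) (per v) (perneg' v) h (-i)
    simp only [neg_neg, neg_add]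
    rw [neg_inj, ← e]; rfl
  · apply right_adjoint_separates (gc' v) (per' v) (perneg v) h (-i)
    simp only [neg_neg, neg_add]
    rw [neg_inj, ← e]; rfl
  · have := right_adjoint_injOn_range (gc v) (per v) h (-i) (-j) (by simpa using e)
    simpa using this
  · have := right_adjoint_injOn_range (gc' v) (per' v) h (-i) (-j) (by simpa using e)
    simpa using this

end Pairs

section Idempotents

variable {A : Type} [Ring A]

/-- A nonzero idempotent that is not a sum of two nonzero orthogonal idempotents. -/
def IsPrimitiveIdem (e : A) : Prop :=
  e * e = e ∧ e ≠ 0 ∧ ∀ g, g * g = g → e * g = g → g * e = g → g = 0 ∨ g = e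

/-- Every additive subgroup closed under the elements `a * e v * b` contains `1`. -/
def GeneratesUnit (E : Set A) : Prop :=
  ∀ I : AddSubgroup A, (∀ e ∈ E, ∀ a b, a * e * b ∈ I) → (1 : A) ∈ I

/-- The elements `x = x * e` with `e` primitive are linearly ordered by left divisibility. -/
theorem IsPrimitiveIdem.left_total (hA : IsNakayamaRing A) {e : A} (he : IsPrimitiveIdem e)
    {x y : A} (hx : x * e = x) (hy : y * e = y) : (∃ a, x = a * y) ∨ ∃ a, y = a * x := by
  obtain ⟨hee, he0, hprim⟩ := he
  let M := Submodule.span A {e}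
  have hmem : ∀ z : A, z ∈ M ↔ z * e = z := by
    intro z
    rw [Submodule.mem_span_singleton]
    constructor
    · rintro ⟨a, rfl⟩; rw [smul_eq_mul, mul_assoc, hee]
    · intro h; exact ⟨z, h⟩
  have hindec : IndecomposableModule A (ModuleCat.of A M) := by
    refine ⟨⟨⟨⟨e, (hmem e).2 hee⟩, 0, fun h => he0 (congrArg Subtype.val h)⟩⟩, ?_⟩
    change ∀ N N' : Submodule A M, _
    intro N N' hc
    let e' : M := ⟨e, (hmem e).2 hee⟩
    have hgen : ∀ z : M, z = z.1 • e' := fun z => Subtype.ext ((hmem z.1).1 z.2).symm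
    obtain ⟨n, hn, n', hn', hsum⟩ := Submodule.mem_sup.1
      (show e' ∈ N ⊔ N' by rw [hc.sup_eq_top]; trivial)
    have hzero : ∀ z ∈ N, z ∈ N' → z = 0 := fun z h1 h2 =>
      (Submodule.disjoint_def.1 hc.disjoint) z h1 h2
    have hsplit : ∀ a : A, a • e' = a • n + a • n' := fun a => by rw [← hsum, smul_add]
    have hnn : n.1 • n = n := by
      have h1 : n - n.1 • n = n.1 • n' := by
        rw [sub_eq_iff_eq_add, add_comm, ← hsplit, ← hgen]
      have := hzero (n - n.1 • n) (N.sub_mem hn (N.smul_mem _ hn))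
        (by rw [h1]; exact N'.smul_mem _ hn')
      exact (sub_eq_zero.1 this).symm
    have hen : e • n = n := by
      have h1 : e • e' = e' := Subtype.ext hee
      have h2 : n - e • n = e • n' - n' := by
        have := hsplit e
        rw [h1, ← hsum] at this
        rw [sub_eq_sub_iff_add_eq_add, this, add_comm]
      have := hzero (n - e • n) (N.sub_mem hn (N.smul_mem _ hn))
        (by rw [h2]; exact N'.sub_mem (N'.smul_mem _ hn') hn')
      exact (sub_eq_zero.1 this).symm
    rcases hprim n.1 (congrArg Subtype.val hnn) (congrArg Subtype.val hen)
      ((hmem n.1).1 n.2) with h | h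
    · left
      have hn0 : n = 0 := Subtype.ext h
      rw [hn0, zero_add] at hsum
      rw [hsum] at hn'
      have : N' = ⊤ := by
        rw [eq_top_iff]
        intro z _
        rw [hgen z]; exact N'.smul_mem _ hn'
      have hd := hc.disjoint
      rwa [this, disjoint_top] at hd
    · right
      have hn0 : n = e' := Subtype.ext h
      rw [hn0] at hn
      rw [eq_top_iff]
      intro z _
      rw [hgen z]; exact N.smul_mem _ hn
  have hfin : Module.Finite A M := inferInstance
  have huni := hA.2 (ModuleCat.of A M) hfin hindec
  have := huni (Submodule.span A {(⟨x, (hmem x).2 hx⟩ : M)})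
    (Submodule.span A {(⟨y, (hmem y).2 hy⟩ : M)})
  rw [Submodule.span_singleton_le_iff_mem, Submodule.span_singleton_le_iff_mem] at this
  refine this.imp (fun h => ?_) fun h => ?_ <;>
  · obtain ⟨a, ha⟩ := Submodule.mem_span_singleton.1 h
    exact ⟨a, (congrArg Subtype.val ha).symm⟩

theorem isPrimitiveIdem_op {e : A} : IsPrimitiveIdem (MulOpposite.op e) ↔ IsPrimitiveIdem e := by
  simp only [IsPrimitiveIdem, MulOpposite.op_surjective.forall, ← MulOpposite.op_mul,
    MulOpposite.op_inj, ne_eq, MulOpposite.op_eq_zero_iff]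
  grind

theorem generatesUnit_primitive [IsArtinianRing A] :
    GeneratesUnit {e : A | IsPrimitiveIdem e} := by
  intro I hI
  suffices ∀ J : Submodule A A, ∀ f : A, f * f = f → Submodule.span A {f} = J → f ∈ I from
    this _ 1 (by simp) rfl
  intro J
  induction J using WellFoundedLT.induction with
  | ind J ih =>
    intro f hf hJ
    by_cases hf0 : f = 0
    · rw [hf0]; exact I.zero_mem
    by_cases hp : IsPrimitiveIdem f
    · simpa [hf] using hI f hp 1 f
    · simp only [IsPrimitiveIdem, hf, ne_eq, hf0, not_false_eq_true, true_and, not_forall,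
        not_or] at hp
      obtain ⟨g, hg, hfg, hgf, hg0, hgne⟩ := hp
      have lt : ∀ u, u * u = u → u * f = u → f ≠ u → f * u = u → Submodule.span A {u} < J := by
        intro u hu huf hne hfu
        rw [← hJ]
        refine lt_of_le_of_ne ?_ ?_
        · rw [Submodule.span_singleton_le_iff_mem, Submodule.mem_span_singleton]
          exact ⟨u, huf⟩
        · intro h
          have : f ∈ Submodule.span A {u} := by rw [h]; exact Submodule.mem_span_singleton_self f
          obtain ⟨a, ha⟩ := Submodule.mem_span_singleton.1 this
          apply hne
          rw [← hfu, ← ha, smul_eq_mul, mul_assoc, hu]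
      have h1 := ih _ (lt g hg hgf (Ne.symm hgne) hfg) g hg rfl
      have h2 : (f - g) * (f - g) = f - g := by
        rw [mul_sub, sub_mul, sub_mul, hf, hgf, hfg, hg]; simp
      have h3 := ih _ (lt (f - g) h2 (by rw [sub_mul, hf, hgf])
        (fun h => hg0 (sub_eq_self.1 h.symm)) (by rw [mul_sub, hf, hfg])) (f - g) h2 rfl
      simpa using I.add_mem h1 h3

theorem GeneratesUnit.exists_finset {E : Set A} (h : GeneratesUnit E) :
    ∃ F : Finset A, (F : Set A) ⊆ E ∧ GeneratesUnit (F : Set A) := by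
  let S := {x : A | ∃ e ∈ E, ∃ a b, x = a * e * b}
  have key : ∀ x ∈ AddSubgroup.closure S, ∃ F : Finset A, (F : Set A) ⊆ E ∧
      ∀ I : AddSubgroup A, (∀ e ∈ F, ∀ a b, a * e * b ∈ I) → x ∈ I := by
    intro x hx
    induction hx using AddSubgroup.closure_induction with
    | mem x hx =>
      obtain ⟨e, he, a, b, rfl⟩ := hx
      exact ⟨{e}, by simpa using he, fun I hI => hI e (by simp) a b⟩
    | zero => exact ⟨∅, by simp, fun I _ => I.zero_mem⟩
    | add x y _ _ hx hy =>
      obtain ⟨F, hF, hF'⟩ := hx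
      obtain ⟨G, hG, hG'⟩ := hy
      exact ⟨F ∪ G, by simp [hF, hG], fun I hI => I.add_mem
        (hF' I fun e he => hI e (Finset.mem_union_left _ he))
        (hG' I fun e he => hI e (Finset.mem_union_right _ he))⟩
    | neg x _ hx =>
      obtain ⟨F, hF, hF'⟩ := hx
      exact ⟨F, hF, fun I hI => I.neg_mem (hF' I hI)⟩
  exact key 1 (h _ fun e he a b => AddSubgroup.subset_closure ⟨e, he, a, b, rfl⟩)

/-- There is a finite generating set of primitive idempotents, none of which lies in the
two-sided ideal of another one. -/
theorem exists_basic_idempotents [IsArtinianRing A] :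
    ∃ F : Finset A, (∀ e ∈ F, IsPrimitiveIdem e) ∧ GeneratesUnit (F : Set A) ∧
      ∀ e ∈ F, ∀ e' ∈ F, (∃ a b, e = a * e' * b) → e = e' := by
  let P : ℕ → Prop := fun n => ∃ F : Finset A, F.card = n ∧ (∀ e ∈ F, IsPrimitiveIdem e) ∧
    GeneratesUnit (F : Set A)
  have hP : ∃ n, P n := by
    obtain ⟨F, hF, hF'⟩ := (generatesUnit_primitive (A := A)).exists_finset
    exact ⟨_, F, rfl, hF, hF'⟩
  obtain ⟨F, hcard, hF, hF'⟩ := Nat.find_spec hP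
  refine ⟨F, hF, hF', fun e he e' he' hab => ?_⟩
  by_contra hne
  obtain ⟨a, b, hab⟩ := hab
  apply Nat.find_min hP (m := (F.erase e).card)
  · rw [← hcard]; exact Finset.card_erase_lt_of_mem he
  · refine ⟨F.erase e, rfl, fun x hx => hF x (Finset.mem_of_mem_erase hx), fun I hI => ?_⟩
    apply hF' I
    intro x hx a' b'
    by_cases hxe : x = e
    · have := hI e' (by simp [he', Ne.symm hne]) (a' * a) (b * b')
      rw [hxe, hab]
      simpa [mul_assoc] using this
    · exact hI x (by simpa [hxe] using hx) a' b'

theorem GeneratesUnit.op {E : Set A} (h : GeneratesUnit E) :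
    GeneratesUnit (MulOpposite.op '' E) := by
  intro I hI
  have := h (I.comap (MulOpposite.opAddEquiv : A ≃+ Aᵐᵒᵖ).toAddMonoidHom) fun e he a b => by
    have := hI _ ⟨e, he, rfl⟩ (MulOpposite.op b) (MulOpposite.op a)
    simpa [← MulOpposite.op_mul, mul_assoc] using this
  simpa using this

/-- If the elements `x = x * e` are linearly ordered by left divisibility, then any such `x` is
generated by some `f * b * x` with `f` in a generating set of idempotents. -/
theorem exists_idem_mul_generator {E : Set A} (hE : GeneratesUnit E) {e x : A}
    (tot : ∀ {x y : A}, x * e = x → y * e = y → (∃ a, x = a * y) ∨ ∃ a, y = a * x)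
    (hx : x * e = x) (hx0 : x ≠ 0) : ∃ f ∈ E, ∃ a b, x = a * (f * b * x) := by
  by_contra! hcon
  have hne : ∀ f ∈ E, ∀ b a : A, x ≠ a * (f * b * x) := fun f hf b a => hcon f hf a b
  -- the elements `y` for which `x` is not a left multiple of `y * x`
  let I : AddSubgroup A :=
    { carrier := {y | ∀ a : A, x ≠ a * (y * x)}
      zero_mem' := fun a => by simpa using hx0
      add_mem' := by
        intro y z hy hz a h
        rcases tot (x := y * x) (y := z * x) (by rw [mul_assoc, hx]) (by rw [mul_assoc, hx])
          with ⟨d, hd⟩ | ⟨d, hd⟩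
        · apply hz (a * (d + 1))
          rw [add_mul, hd] at h
          conv_lhs => rw [h]
          noncomm_ring
        · apply hy (a * (1 + d))
          rw [add_mul, hd] at h
          conv_lhs => rw [h]
          noncomm_ring
      neg_mem' := by
        intro y hy a h
        apply hy (-a)
        conv_lhs => rw [h]
        noncomm_ring }
  have : (1 : A) ∈ I := by
    apply hE
    intro f hf a b c h
    apply hne f hf b (c * a)
    conv_lhs => rw [h]
    noncomm_ring
  exact this 1 (by simp)

/-- Nongenerators of `A * e` are closed under addition. -/
theorem not_left_invertible_add {e x y : A}
    (tot : ∀ {x y : A}, x * e = x → y * e = y → (∃ a, x = a * y) ∨ ∃ a, y = a * x)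
    (hx : x * e = x) (hy : y * e = y) (h : ∃ z, z * (x + y) = e) :
    (∃ z, z * x = e) ∨ ∃ z, z * y = e := by
  obtain ⟨z, hz⟩ := h
  rcases tot hx hy with ⟨a, ha⟩ | ⟨a, ha⟩
  · right
    exact ⟨z * (a + 1), by rw [← hz, ha]; noncomm_ring⟩
  · left
    exact ⟨z * (1 + a), by rw [← hz, ha]; noncomm_ring⟩

/-- A left invertible element between primitive idempotents is right invertible. -/
theorem IsPrimitiveIdem.right_inverse {e f x : A} (he : IsPrimitiveIdem e)
    (hf : IsPrimitiveIdem f) (hx : x * e = x) (hfx : f * x = x) (h : ∃ z, z * x = e) :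
    ∃ z, x * z = f := by
  obtain ⟨z, hz⟩ := h
  refine ⟨e * z * f, ?_⟩
  have h1 : e * z * f * x = e := by rw [mul_assoc, hfx, mul_assoc, hz, he.1]
  have h0 : x * (e * z * f) * x = x := by rw [mul_assoc, h1, hx]
  rcases hf.2.2 (x * (e * z * f)) (by rw [← mul_assoc, h0])
    (by rw [← mul_assoc, hfx]) (by simp only [mul_assoc, hf.1]) with h | h
  · rw [h, zero_mul] at h0
    rw [← h0, mul_zero] at hz
    exact absurd hz.symm he.2.1
  · exact h

/-- A right invertible element between primitive idempotents is left invertible. -/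
theorem IsPrimitiveIdem.left_inverse {e f x : A} (he : IsPrimitiveIdem e)
    (hf : IsPrimitiveIdem f) (hx : x * e = x) (hfx : f * x = x) (h : ∃ z, x * z = f) :
    ∃ z, z * x = e := by
  have := (isPrimitiveIdem_op.2 hf).right_inverse (isPrimitiveIdem_op.2 he) (x := .op x)
    (by rw [← MulOpposite.op_mul, hfx]) (by rw [← MulOpposite.op_mul, hx])
    (by simpa only [MulOpposite.op_surjective.exists, ← MulOpposite.op_mul,
          MulOpposite.op_inj] using h)
  simpa only [MulOpposite.op_surjective.exists, ← MulOpposite.op_mul,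
    MulOpposite.op_inj] using this

/-- The radical of `A * e` is generated by one element `α`, which can be chosen in `f * A` for
some `f` in a given generating set of idempotents. -/
theorem exists_radical_generator [IsArtinianRing A] {E : Set A} (hE : GeneratesUnit E)
    (hidem : ∀ f ∈ E, f * f = f) {e : A} (he : IsPrimitiveIdem e)
    (tot : ∀ {x y : A}, x * e = x → y * e = y → (∃ a, x = a * y) ∨ ∃ a, y = a * x) :
    ∃ α : A, α * e = α ∧ (¬ ∃ z, z * α = e) ∧ (α ≠ 0 → ∃ f ∈ E, f * α = α) ∧
      ∀ x, x * e = x → (∃ z, z * x = e) ∨ ∃ z, x = z * α := by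
  let R : Submodule A A :=
    { carrier := {x | x * e = x ∧ ¬ ∃ z, z * x = e}
      zero_mem' := ⟨by simp, by simpa using he.2.1.symm⟩
      add_mem' := by
        intro x y hx hy
        refine ⟨by rw [add_mul, hx.1, hy.1], fun h => ?_⟩
        rcases not_left_invertible_add tot hx.1 hy.1 h with h | h
        exacts [hx.2 h, hy.2 h]
      smul_mem' := by
        rintro a x ⟨hx, hx'⟩
        refine ⟨by rw [smul_eq_mul, mul_assoc, hx], fun ⟨z, hz⟩ => hx' ⟨z * a, ?_⟩⟩
        rw [mul_assoc]; exact hz }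
  have hfg : R.FG := IsNoetherian.noetherian R
  have key : ∃ α ∈ R, R = Submodule.span A {α} := by
    have : ∀ N : Submodule A A, N.FG → N ≤ R → ∃ α ∈ R, N = Submodule.span A {α} := by
      intro N hN
      induction N, hN using Submodule.fg_induction with
      | singleton x =>
        intro h
        exact ⟨x, h (Submodule.mem_span_singleton_self x), rfl⟩
      | sup N₁ N₂ _ _ h₁ h₂ =>
        intro h
        obtain ⟨α, hα, rfl⟩ := h₁ (le_sup_left.trans h)
        obtain ⟨β, hβ, rfl⟩ := h₂ (le_sup_right.trans h)
        rcases tot hα.1 hβ.1 with ⟨a, ha⟩ | ⟨a, ha⟩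
        · refine ⟨β, hβ, sup_eq_right.2 ?_⟩
          rw [Submodule.span_singleton_le_iff_mem, Submodule.mem_span_singleton]
          exact ⟨a, ha.symm⟩
        · refine ⟨α, hα, sup_eq_left.2 ?_⟩
          rw [Submodule.span_singleton_le_iff_mem, Submodule.mem_span_singleton]
          exact ⟨a, ha.symm⟩
    exact this R hfg le_rfl
  obtain ⟨α, hα, hR⟩ := key
  have hgen : ∀ x, x * e = x → (∃ z, z * x = e) ∨ ∃ z, x = z * α := by
    intro x hx
    by_cases h : ∃ z, z * x = e
    · exact Or.inl h
    · right
      have : x ∈ R := ⟨hx, h⟩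
      rw [hR, Submodule.mem_span_singleton] at this
      obtain ⟨a, ha⟩ := this
      exact ⟨a, ha.symm⟩
  by_cases hα0 : α = 0
  · exact ⟨α, hα.1, hα.2, fun h => absurd hα0 h, hgen⟩
  · obtain ⟨f, hf, a, b, hab⟩ := exists_idem_mul_generator hE tot hα.1 hα0
    refine ⟨f * b * α, by rw [mul_assoc, hα.1], fun ⟨z, hz⟩ => hα.2 ⟨z * (f * b), ?_⟩,
      fun _ => ⟨f, hf, by simp only [← mul_assoc, hidem f hf]⟩, fun x hx => ?_⟩
    · rw [mul_assoc, hz]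
    · refine (hgen x hx).imp_right fun ⟨z, hz⟩ => ⟨z * a, ?_⟩
      rw [mul_assoc, ← hab, hz]

/-- If `t` fixes a nonzero element of `e * A`, then `t` is left invertible in `e * A * e`. -/
theorem left_invertible_of_fixes {e t x : A}
    (tot : ∀ {x y : A}, x * e = x → y * e = y → (∃ a, x = a * y) ∨ ∃ a, y = a * x)
    (he : e * e = e) (ht : t * e = t) (hex : e * x = x) (hx : x ≠ 0) (h : t * x = x) :
    ∃ z, z * t = e := by
  rcases not_left_invertible_add tot (x := t) (y := e - t) ht (by rw [sub_mul, he, ht])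
    ⟨e, by rw [add_sub_cancel, he]⟩ with h' | ⟨z, hz⟩
  · exact h'
  · exfalso
    apply hx
    rw [← hex, ← hz, mul_assoc, sub_mul, hex, h, sub_self, mul_zero]

/-- The module `A * e` is projective. -/
theorem projective_span_idem {e : A} (he : e * e = e) :
    Module.Projective A (Submodule.span A {e}) := by
  refine Module.Projective.of_split (Submodule.span A {e}).subtype
    (LinearMap.toSpanSingleton A _ ⟨e, Submodule.mem_span_singleton_self e⟩) ?_
  ext ⟨x, hx⟩
  obtain ⟨a, rfl⟩ := Submodule.mem_span_singleton.1 hx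
  simp [mul_assoc, he]

/-- If every element of `A * e` is zero or a generator, then `A * e` is simple. -/
theorem isSimpleModule_span_idem {e : A} (he : e * e = e) (he0 : e ≠ 0)
    (h : ∀ x, x * e = x → (∃ z, z * x = e) ∨ x = 0) :
    IsSimpleModule A (Submodule.span A {e}) := by
  rw [isSimpleModule_iff_toSpanSingleton_surjective]
  refine ⟨⟨⟨e, Submodule.mem_span_singleton_self e⟩, 0, fun h => he0 (congrArg Subtype.val h)⟩, ?_⟩
  rintro ⟨x, hx⟩ hx0 ⟨y, hy⟩
  obtain ⟨a, rfl⟩ := Submodule.mem_span_singleton.1 hx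
  obtain ⟨b, rfl⟩ := Submodule.mem_span_singleton.1 hy
  rcases h (a • e) (by rw [smul_eq_mul, mul_assoc, he]) with ⟨z, hz⟩ | h
  · exact ⟨b * z, Subtype.ext (by simp [mul_assoc] at hz ⊢; rw [hz])⟩
  · exact absurd (Subtype.ext h) hx0

/-- The right-hand version of `exists_radical_generator`. -/
theorem exists_right_radical_generator (hA : IsNakayamaRing Aᵐᵒᵖ) {E : Set A}
    (hE : GeneratesUnit E) (hidem : ∀ f ∈ E, f * f = f) {e : A} (he : IsPrimitiveIdem e) :
    ∃ β : A, e * β = β ∧ (¬ ∃ z, β * z = e) ∧ (β ≠ 0 → ∃ f ∈ E, β * f = β) ∧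
      ∀ x, e * x = x → (∃ z, x * z = e) ∨ ∃ z, x = β * z := by
  have := hA.1
  have := exists_radical_generator hE.op
    (by rintro _ ⟨f, hf, rfl⟩; rw [← MulOpposite.op_mul, hidem f hf])
    (isPrimitiveIdem_op.2 he) ((isPrimitiveIdem_op.2 he).left_total hA)
  simpa only [MulOpposite.op_surjective.exists, MulOpposite.op_surjective.forall,
    ← MulOpposite.op_mul, MulOpposite.op_inj, MulOpposite.op_injective.mem_set_image, ne_eq,
    MulOpposite.op_eq_zero_iff] using this

/-- A nonzero generator in `f * A * e` of the radical of `A * e` also generates the radical of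
`f * A`. -/
theorem right_radical_of_left_radical (hA : IsNakayamaAlgebra A) {E : Set A}
    (hE : GeneratesUnit E) (hprim : ∀ f ∈ E, IsPrimitiveIdem f) {e f α : A}
    (he : IsPrimitiveIdem e) (hf : IsPrimitiveIdem f) (hα0 : α ≠ 0) (hαe : α * e = α)
    (hfα : f * α = α) (hα : ¬ ∃ z, z * α = e)
    (hgen : ∀ x, x * e = x → (∃ z, z * x = e) ∨ ∃ z, x = z * α) :
    ∀ x, f * x = x → (∃ z, x * z = f) ∨ ∃ z, x = α * z := by
  obtain ⟨β, hfβ, hβ, hβE, hβgen⟩ :=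
    exists_right_radical_generator hA.2 hE (fun f hf => (hprim f hf).1) hf
  have hαr : ¬ ∃ z, α * z = f := fun h => hα (he.left_inverse hf hαe hfα h)
  obtain ⟨γ₀, hγ₀⟩ := (hβgen α hfα).resolve_left hαr
  have hβ0 : β ≠ 0 := by
    rintro rfl
    exact hα0 (by rw [hγ₀, zero_mul])
  obtain ⟨g, hg, hβg⟩ := hβE hβ0
  have hαγ : α = β * (g * γ₀ * e) := by
    rw [← mul_assoc, ← mul_assoc, hβg, ← hγ₀, hαe]
  have hγe : g * γ₀ * e * e = g * γ₀ * e := by rw [mul_assoc, he.1]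
  have hgγ : g * (g * γ₀ * e) = g * γ₀ * e := by simp only [← mul_assoc, (hprim g hg).1]
  suffices ∃ z, β = α * z by
    obtain ⟨z, hz⟩ := this
    intro x hx
    refine (hβgen x hx).imp_right fun ⟨y, hy⟩ => ⟨z * y, ?_⟩
    rw [← mul_assoc, ← hz, hy]
  rcases hgen _ hγe with hinv | ⟨δ, hδ⟩
  · obtain ⟨z, hz⟩ := he.right_inverse (hprim g hg) hγe hgγ hinv
    exact ⟨z, by rw [hαγ, mul_assoc, hz, hβg]⟩
  · exfalso
    have hfix : β * δ * f * α = α := by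
      rw [mul_assoc (β * δ), hfα, mul_assoc, ← hδ, ← hαγ]
    obtain ⟨z, hz⟩ := left_invertible_of_fixes (hf.left_total hA.1) hf.1
      (by rw [mul_assoc (β * δ), hf.1]) hfα hα0 hfix
    obtain ⟨y, hy⟩ := hf.right_inverse hf (by rw [mul_assoc (β * δ), hf.1])
      (by simp only [← mul_assoc, hfβ]) ⟨z, hz⟩
    exact hβ ⟨δ * f * y, by simpa only [mul_assoc] using hy⟩

end Idempotents

section Quiver

/-- A cyclic quiver presentation of a ring: idempotents indexed by the vertices, a permutation of
the vertices, and for every vertex `v` an arrow from `v` to `next v` which generates both the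
radical of `A * e v` and that of `e (next v) * A`. -/
structure CyclicQuiver (A : Type) [Ring A] (V : Type) where
  idem : V → A
  next : Equiv.Perm V
  arrow : V → A
  idem_mul_idem : ∀ v, idem v * idem v = idem v
  arrow_mul_idem : ∀ v, arrow v * idem v = arrow v
  idem_mul_arrow : ∀ v, idem (next v) * arrow v = arrow v
  arrow_ne_zero : ∀ v, arrow v ≠ 0
  left_generates : ∀ v x, x * idem v = x → (∃ z, z * x = idem v) ∨ ∃ z, x = z * arrow v
  right_generates : ∀ v x, idem (next v) * x = x →
    (∃ z, x * z = idem (next v)) ∨ ∃ z, x = arrow v * z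
  not_left_invertible : ∀ v, ¬ ∃ z, z * arrow v = idem v
  not_right_invertible : ∀ v, ¬ ∃ z, arrow v * z = idem (next v)
  generatesUnit : GeneratesUnit (Set.range idem)

namespace CyclicQuiver

variable {A : Type} [Ring A] {V : Type} (Q : CyclicQuiver A V)

/-- The path of length `k` starting at `v`. -/
def path : ℕ → V → A
  | 0, v => Q.idem v
  | k + 1, v => path k (Q.next v) * Q.arrow v

theorem path_succ (k : ℕ) (v : V) : Q.path (k + 1) v = Q.path k (Q.next v) * Q.arrow v := rfl

theorem path_add (k l : ℕ) (v : V) : Q.path (k + l) v = Q.path k ((Q.next ^ l) v) * Q.path l v := by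
  induction l generalizing v with
  | zero =>
    cases k with
    | zero => exact (Q.idem_mul_idem v).symm
    | succ k =>
      simp only [add_zero, pow_zero, Equiv.Perm.one_apply, path_succ]
      rw [path, mul_assoc, Q.arrow_mul_idem]
  | succ l ih =>
    rw [← add_assoc, path_succ, ih, path_succ, mul_assoc, pow_succ, Equiv.Perm.mul_apply]

theorem path_one (v : V) : Q.path 1 v = Q.arrow v := Q.idem_mul_arrow v

theorem path_mul_idem (k : ℕ) (v : V) : Q.path k v * Q.idem v = Q.path k v :=
  (Q.path_add k 0 v).symm

theorem idem_mul_path (k : ℕ) (v : V) : Q.idem ((Q.next ^ k) v) * Q.path k v = Q.path k v := by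
  have := Q.path_add 0 k v
  rw [zero_add] at this
  exact this.symm

/-- The opposite quiver. -/
def op : CyclicQuiver Aᵐᵒᵖ V where
  idem v := .op (Q.idem v)
  next := Q.next⁻¹
  arrow v := .op (Q.arrow (Q.next⁻¹ v))
  idem_mul_idem v := by rw [← MulOpposite.op_mul, Q.idem_mul_idem]
  arrow_mul_idem v := by
    have := Q.idem_mul_arrow (Q.next⁻¹ v)
    rw [show Q.next (Q.next⁻¹ v) = v from Q.next.apply_symm_apply v] at this
    rw [← MulOpposite.op_mul, this]
  idem_mul_arrow v := by rw [← MulOpposite.op_mul, Q.arrow_mul_idem]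
  arrow_ne_zero v := by simpa using Q.arrow_ne_zero _
  left_generates v := by
    have := Q.right_generates (Q.next⁻¹ v)
    rw [show Q.next (Q.next⁻¹ v) = v from Q.next.apply_symm_apply v] at this
    simpa only [MulOpposite.op_surjective.exists, MulOpposite.op_surjective.forall,
      ← MulOpposite.op_mul, MulOpposite.op_inj] using this
  right_generates v := by
    have := Q.left_generates (Q.next⁻¹ v)
    simpa only [MulOpposite.op_surjective.exists, MulOpposite.op_surjective.forall,
      ← MulOpposite.op_mul, MulOpposite.op_inj] using this
  not_left_invertible v := by
    have := Q.not_right_invertible (Q.next⁻¹ v)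
    rw [show Q.next (Q.next⁻¹ v) = v from Q.next.apply_symm_apply v] at this
    simpa only [MulOpposite.op_surjective.exists, ← MulOpposite.op_mul,
      MulOpposite.op_inj] using this
  not_right_invertible v := by
    have := Q.not_left_invertible (Q.next⁻¹ v)
    simpa only [MulOpposite.op_surjective.exists, ← MulOpposite.op_mul,
      MulOpposite.op_inj] using this
  generatesUnit := by
    have := Q.generatesUnit.op
    rwa [← Set.range_comp] at this

theorem op_path (k : ℕ) (v : V) : Q.op.path k ((Q.next ^ k) v) = .op (Q.path k v) := by
  induction k generalizing v with
  | zero => rfl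
  | succ k ih =>
    rw [path_succ, add_comm k 1, path_add, path_one, MulOpposite.op_mul, ← ih]
    change Q.op.path k (Q.next⁻¹ ((Q.next ^ (1 + k)) v)) *
      .op (Q.arrow (Q.next⁻¹ ((Q.next ^ (1 + k)) v))) = _
    rw [pow_add, pow_one, Equiv.Perm.mul_apply]
    rw [show ∀ w, Q.next⁻¹ (Q.next w) = w from Q.next.symm_apply_apply]

/-- All sufficiently long paths vanish. -/
def Nilpotent : Prop := ∃ N, ∀ v, Q.path N v = 0

variable {Q}

theorem path_eq_zero_of_le {k l : ℕ} {v : V} (hkl : k ≤ l) (h : Q.path k v = 0) :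
    Q.path l v = 0 := by
  obtain ⟨m, rfl⟩ := Nat.exists_eq_add_of_le' hkl
  rw [path_add, h, mul_zero]

theorem nilpotent_of_isArtinianRing [IsArtinianRing A] [Finite V]
    (tot : ∀ {v : V} {x y : A}, x * Q.idem v = x → y * Q.idem v = y →
      (∃ a, x = a * y) ∨ ∃ a, y = a * x) : Q.Nilpotent := by
  have key : ∀ v, ∃ k, Q.path k v = 0 := by
    intro v
    let s : ℕ →o (Submodule A A)ᵒᵈ :=
      { toFun := fun k => OrderDual.toDual (Submodule.span A {Q.path k v})
        monotone' := by
          intro k l hkl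
          obtain ⟨m, rfl⟩ := Nat.exists_eq_add_of_le' hkl
          rw [OrderDual.toDual_le_toDual, Submodule.span_singleton_le_iff_mem,
            Submodule.mem_span_singleton]
          exact ⟨_, (Q.path_add m k v).symm⟩ }
    obtain ⟨k, hk⟩ := IsArtinian.monotone_stabilizes s
    refine ⟨k, ?_⟩
    have h1 : Submodule.span A {Q.path k v} = Submodule.span A {Q.path (1 + k) v} :=
      hk (1 + k) (by omega)
    have h2 : Q.path k v ∈ Submodule.span A {Q.path (1 + k) v} := by
      rw [← h1]; exact Submodule.mem_span_singleton_self _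
    obtain ⟨y, hy⟩ := Submodule.mem_span_singleton.1 h2
    by_contra hne
    rw [path_add, path_one, smul_eq_mul, ← mul_assoc] at hy
    obtain ⟨z, hz⟩ := left_invertible_of_fixes tot (Q.idem_mul_idem _)
      (by rw [mul_assoc, Q.arrow_mul_idem]) (Q.idem_mul_path k v) hne hy
    exact Q.not_left_invertible _ ⟨z * y, by rw [mul_assoc, hz]⟩
  choose c hc using key
  obtain ⟨N, hN⟩ := (Set.finite_range c).bddAbove
  exact ⟨N, fun v => path_eq_zero_of_le (hN ⟨v, rfl⟩) (hc v)⟩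

theorem Nilpotent.op (h : Q.Nilpotent) : Q.op.Nilpotent := by
  obtain ⟨N, hN⟩ := h
  refine ⟨N, fun v => ?_⟩
  obtain ⟨w, rfl⟩ := (Q.next ^ N).surjective v
  rw [op_path, hN, MulOpposite.op_zero]

end CyclicQuiver

/-- A cyclic Nakayama algebra has a finite cyclic quiver. -/
theorem IsCyclicNakayama.exists_cyclicQuiver {A : Type} [Ring A] (hA : IsCyclicNakayama A) :
    ∃ (V : Type) (_ : Finite V) (Q : CyclicQuiver A V), Q.Nilpotent := by
  obtain ⟨hN, -, hS⟩ := hA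
  have := hN.1.1
  obtain ⟨F, hprim, hgen, hbasic⟩ := exists_basic_idempotents (A := A)
  have step : ∀ e : F, ∃ (f : F) (α : A), α ≠ 0 ∧ α * e.1 = α ∧ f.1 * α = α ∧
      (∀ x, x * e.1 = x → (∃ z, z * x = e.1) ∨ ∃ z, x = z * α) ∧
      (∀ x, f.1 * x = x → (∃ z, x * z = f.1) ∨ ∃ z, x = α * z) ∧
      (¬ ∃ z, z * α = e.1) ∧ ¬ ∃ z, α * z = f.1 := by
    rintro ⟨e, heF⟩
    have he := hprim e heF
    obtain ⟨α, hαe, hα, hαf, hαgen⟩ := exists_radical_generator hgen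
      (fun f hf => (hprim f hf).1) he (he.left_total hN.1)
    have hα0 : α ≠ 0 := by
      rintro rfl
      refine hS (ModuleCat.of A (Submodule.span A {e})) (isSimpleModule_span_idem he.1 he.2.1 ?_)
        (projective_span_idem he.1)
      simpa using hαgen
    obtain ⟨f, hf, hfα⟩ := hαf hα0
    exact ⟨⟨f, hf⟩, α, hα0, hαe, hfα, hαgen, right_radical_of_left_radical hN hgen hprim he
      (hprim f hf) hα0 hαe hfα hα hαgen, hα, fun h => hα (he.left_inverse (hprim f hf) hαe hfα h)⟩
  choose ν α hα0 hαe hfα hl hr hnl hnr using step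
  have hinj : Function.Injective ν := by
    intro e e' h
    obtain ⟨γ, hγ⟩ := (hr e' (α e) (by rw [← h, hfα])).resolve_left (by rw [← h]; exact hnr e)
    obtain ⟨δ, hδ⟩ := (hr e (α e') (by rw [h, hfα])).resolve_left (by rw [h]; exact hnr e')
    have he := hprim e.1 e.2
    have hfix : α e * (δ * e'.1 * γ) = α e := by
      rw [← mul_assoc, ← mul_assoc, ← hδ, hαe, ← hγ]
    have hinv : ∃ z, e.1 * (δ * e'.1 * γ) * z = e.1 := by
      have := left_invertible_of_fixes (A := Aᵐᵒᵖ) (e := .op e.1)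
        (t := .op (e.1 * (δ * e'.1 * γ))) (x := .op (α e))
        ((isPrimitiveIdem_op.2 he).left_total hN.2) (by rw [← MulOpposite.op_mul, he.1])
        (by rw [← MulOpposite.op_mul, ← mul_assoc, he.1])
        (by rw [← MulOpposite.op_mul, hαe]) (by simpa using hα0 e)
        (by rw [← MulOpposite.op_mul, ← mul_assoc, hαe, hfix])
      simpa only [MulOpposite.op_surjective.exists, ← MulOpposite.op_mul,
        MulOpposite.op_inj] using this
    obtain ⟨z, hz⟩ := hinv
    exact Subtype.ext (hbasic e.1 e.2 e'.1 e'.2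
      ⟨e.1 * δ, γ * z, by simpa only [mul_assoc] using hz.symm⟩)
  let νp : Equiv.Perm F := Equiv.ofBijective ν (Finite.injective_iff_bijective.1 hinj)
  let Q : CyclicQuiver A F := ⟨fun e => e.1, νp, α, fun e => (hprim e.1 e.2).1, hαe, hfα, hα0,
    hl, hr, hnl, hnr, by convert hgen; exact Subtype.range_coe⟩
  exact ⟨F, inferInstance, Q, CyclicQuiver.nilpotent_of_isArtinianRing
    fun {v} => (hprim v.1 v.2).left_total hN.1⟩

end Quiver

section ProjectiveDimension

open CategoryTheory

variable {A : Type} [Ring A] {M N P : Type} [AddCommGroup M] [Module A M] [AddCommGroup N]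
  [Module A N] [AddCommGroup P] [Module A P]

/-- The module `M` has projective dimension at most `n`, in the sense of `Ext` groups. -/
def PDimLE (A : Type) [Ring A] (n : ℕ) (M : Type) [AddCommGroup M] [Module A M] : Prop :=
  HasProjectiveDimensionLE (ModuleCat.of A M) n

theorem PDimLE.of_equiv {n : ℕ} (h : PDimLE A n M) (e : M ≃ₗ[A] N) : PDimLE A n N := by
  have h' : HasProjectiveDimensionLT (ModuleCat.of A M) (n + 1) := h
  exact hasProjectiveDimensionLT_of_iso e.toModuleIso (n + 1)

theorem pDimLE_congr {n : ℕ} (e : M ≃ₗ[A] N) : PDimLE A n M ↔ PDimLE A n N :=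
  ⟨fun h => h.of_equiv e, fun h => h.of_equiv e.symm⟩

theorem pDimLE_zero_iff : PDimLE A 0 M ↔ Module.Projective A M := by
  unfold PDimLE
  rw [← projective_iff_hasProjectiveDimensionLE_zero]
  exact (IsProjective.iff_projective (R := A) M).symm

theorem PDimLE.mono {m n : ℕ} (h : PDimLE A m M) (hmn : m ≤ n) : PDimLE A n M := by
  have h' : HasProjectiveDimensionLT (ModuleCat.of A M) (m + 1) := h
  exact hasProjectiveDimensionLT_of_ge (ModuleCat.of A M) (m + 1) (n + 1) (by omega)

theorem pDimLE_succ_iff [Module.Projective A P] {f : P →ₗ[A] M} (hf : Surjective f) {n : ℕ} :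
    PDimLE A (n + 1) M ↔ PDimLE A n (LinearMap.ker f) :=
  (LinearMap.shortExact_shortComplexKer hf).hasProjectiveDimensionLT_X₃_iff n
    ((IsProjective.iff_projective (R := A) P).mp inferInstance)

theorem pDimLE_prod_iff {n : ℕ} : PDimLE A n (M × N) ↔ PDimLE A n M ∧ PDimLE A n N := by
  constructor
  · intro h
    have h' : HasProjectiveDimensionLT (ModuleCat.of A (M × N)) (n + 1) := h
    constructor
    · exact Retract.hasProjectiveDimensionLT (X := ModuleCat.of A M) (Y := ModuleCat.of A (M × N))
        { i := ModuleCat.ofHom (LinearMap.inl A M N)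
          r := ModuleCat.ofHom (LinearMap.fst A M N)
          retract := by ext; simp } (n + 1)
    · exact Retract.hasProjectiveDimensionLT (X := ModuleCat.of A N) (Y := ModuleCat.of A (M × N))
        { i := ModuleCat.ofHom (LinearMap.inr A M N)
          r := ModuleCat.ofHom (LinearMap.snd A M N)
          retract := by ext; simp } (n + 1)
  · rintro ⟨h₁, h₂⟩
    have hS := ModuleCat.shortComplex_shortExact
      (ModuleCat.shortComplexOfCompEqZero (LinearMap.inl A M N) (LinearMap.snd A M N)
        (LinearMap.snd_comp_inl A M N)) (by
          intro x
          constructor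
          · intro hx
            exact ⟨x.1, Prod.ext rfl (Eq.symm hx)⟩
          · rintro ⟨y, rfl⟩
            rfl) LinearMap.inl_injective LinearMap.snd_surjective
    exact hS.hasProjectiveDimensionLT_X₂ (n + 1) h₁ h₂

theorem exists_projective_cover [IsArtinianRing A] [Module.Finite A M] :
    ∃ (P : Type) (_ : AddCommGroup P) (_ : Module A P) (f : P →ₗ[A] M),
      Module.Projective A P ∧ Module.Finite A P ∧ Surjective f ∧
        IsSmallSubmodule A (LinearMap.ker f) := by
  obtain ⟨n, f, hf⟩ := Module.Finite.exists_fin' A M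
  let S : Set (Submodule A (Fin n → A)) := {Q | Module.Projective A Q ∧ Q.map f = ⊤}
  have hS : S.Nonempty := by
    refine ⟨⊤, Module.Projective.of_equiv (Submodule.topEquiv (R := A)).symm, ?_⟩
    rw [Submodule.map_top, LinearMap.range_eq_top.mpr hf]
  obtain ⟨Q, hQ⟩ := (wellFounded_lt (α := Submodule A (Fin n → A))).has_min S hS
  obtain ⟨⟨hQproj, hQmap⟩, hmin⟩ := hQ
  have hg : Surjective (f ∘ₗ Q.subtype) := by
    rw [← LinearMap.range_eq_top, LinearMap.range_comp, Submodule.range_subtype, hQmap]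
  refine ⟨Q, inferInstance, inferInstance, f ∘ₗ Q.subtype, hQproj, inferInstance, hg, ?_⟩
  intro K hK
  have hgK : Surjective ((f ∘ₗ Q.subtype) ∘ₗ K.subtype) := by
    rw [← LinearMap.range_eq_top, LinearMap.range_comp, Submodule.range_subtype]
    have h := congrArg (Submodule.map (f ∘ₗ Q.subtype)) hK
    rw [Submodule.map_sup, Submodule.map_top, LinearMap.range_eq_top.mpr hg] at h
    rw [← h, eq_comm, sup_eq_right]
    rintro _ ⟨x, hx, rfl⟩
    rw [LinearMap.mem_ker.mp hx]
    exact zero_mem _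
  obtain ⟨l, hl⟩ := Module.projective_lifting_property _ (f ∘ₗ Q.subtype) hgK
  let h : Module.End A Q := K.subtype ∘ₗ l
  have hh : (f ∘ₗ Q.subtype) ∘ₗ h = f ∘ₗ Q.subtype := hl
  have hpow : ∀ m : ℕ, (f ∘ₗ Q.subtype) ∘ₗ (h ^ m : Module.End A Q) = f ∘ₗ Q.subtype := by
    intro m
    induction m with
    | zero => rfl
    | succ m ih =>
      rw [pow_succ', Module.End.mul_eq_comp, ← LinearMap.comp_assoc, hh, ih]
  obtain ⟨m, hm⟩ := Filter.eventually_atTop.mp (LinearMap.eventually_isCompl_ker_pow_range_pow h)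
  have hcompl := hm (m + 1) (Nat.le_succ m)
  set R := LinearMap.range (h ^ (m + 1)) with hR
  have hRproj : Module.Projective A R := by
    have := Module.Projective.of_equiv (Submodule.prodEquivOfIsCompl _ _ hcompl).symm
    exact Module.Projective.of_split (LinearMap.inr A (LinearMap.ker (h ^ (m + 1))) R)
      (LinearMap.snd A (LinearMap.ker (h ^ (m + 1))) R) (by ext; simp)
  have hmem : R.map Q.subtype ∈ S := by
    refine ⟨Module.Projective.of_equiv (Submodule.equivSubtypeMap Q R), ?_⟩
    rw [← Submodule.map_comp, hR, ← LinearMap.range_comp, hpow, LinearMap.range_eq_top.mpr hg]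
  have hle : R.map Q.subtype ≤ Q := Submodule.map_subtype_le Q R
  have heq : R.map Q.subtype = Q := by
    by_contra hne
    exact hmin _ hmem (lt_of_le_of_ne hle hne)
  rw [eq_top_iff]
  intro x _
  have hx : (x : Fin n → A) ∈ R.map Q.subtype := by
    rw [heq]
    exact x.2
  obtain ⟨y, ⟨z, rfl⟩, hy⟩ := hx
  have : x = h ((h ^ m) z) := by
    rw [← Module.End.mul_apply, ← pow_succ']
    exact Subtype.ext hy.symm
  rw [this]
  exact (l _).2

theorem IsSyzygyOf.finite [IsArtinianRing A] {N M : ModuleCat.{0} A} (h : IsSyzygyOf A N M) :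
    Module.Finite A N := by
  obtain ⟨P, f, _, _, _, _, ⟨e⟩⟩ := h
  exact Module.Finite.equiv e.symm

theorem IsSyzygyOf.pDimLE_iff {N M : ModuleCat.{0} A} (h : IsSyzygyOf A N M) {n : ℕ} :
    PDimLE A (n + 1) M ↔ PDimLE A n N := by
  obtain ⟨P, f, _, _, hf, _, ⟨e⟩⟩ := h
  rw [pDimLE_succ_iff hf, pDimLE_congr e]

theorem exists_isSyzygyOf [IsArtinianRing A] (M : ModuleCat.{0} A) [Module.Finite A M] :
    ∃ N, IsSyzygyOf A N M := by
  obtain ⟨P, _, _, f, h₁, h₂, h₃, h₄⟩ := exists_projective_cover (A := A) (M := M)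
  exact ⟨ModuleCat.of A (LinearMap.ker f), ModuleCat.of A P, f, h₁, h₂, h₃, h₄,
    ⟨LinearEquiv.refl A _⟩⟩

theorem exists_isNthSyzygyOf [IsArtinianRing A] (M : ModuleCat.{0} A) [Module.Finite A M] (n : ℕ) :
    ∃ N : ModuleCat.{0} A, Module.Finite A N ∧ IsNthSyzygyOf A n N M := by
  induction n with
  | zero => exact ⟨M, inferInstance, ⟨LinearEquiv.refl A _⟩⟩
  | succ n ih =>
    obtain ⟨K, _, hK⟩ := ih
    obtain ⟨N, hN⟩ := exists_isSyzygyOf K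
    exact ⟨N, hN.finite, K, hK, hN⟩

theorem IsNthSyzygyOf.pDimLE_iff {n : ℕ} {N M : ModuleCat.{0} A} (h : IsNthSyzygyOf A n N M)
    {m : ℕ} : PDimLE A (n + m) M ↔ PDimLE A m N := by
  induction n generalizing N m with
  | zero =>
    obtain ⟨e⟩ := h
    rw [zero_add, pDimLE_congr e]
  | succ n ih =>
    obtain ⟨K, hK, hN⟩ := h
    rw [← hN.pDimLE_iff, ← ih hK, Nat.add_right_comm, Nat.add_assoc]

theorem projDim_le_iff [IsArtinianRing A] (M : ModuleCat.{0} A) [Module.Finite A M] {n : ℕ} :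
    projDim A M ≤ n ↔ PDimLE A n M := by
  constructor
  · intro h
    have hne : ((fun n : ℕ => (n : ℕ∞)) '' {n : ℕ | ∃ N : ModuleCat.{0} A,
        IsNthSyzygyOf A n N M ∧ Module.Projective A ↥N}).Nonempty := by
      by_contra hne
      rw [projDim, Set.not_nonempty_iff_eq_empty.mp hne, sInf_empty] at h
      exact ENat.natCast_ne_top n (top_le_iff.mp h)
    obtain ⟨k, ⟨N, hN, hproj⟩, hk⟩ := csInf_mem hne
    have hkn : k ≤ n := by
      rw [projDim, ← hk] at h
      exact Nat.cast_le.mp h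
    exact (hN.pDimLE_iff.mpr (pDimLE_zero_iff.mpr hproj)).mono hkn
  · intro h
    obtain ⟨N, _, hN⟩ := exists_isNthSyzygyOf M n
    exact sInf_le ⟨n, ⟨N, hN, pDimLE_zero_iff.mp (hN.pDimLE_iff.mp h)⟩, rfl⟩

theorem finDim_le_iff [IsArtinianRing A] {d : ℕ} :
    finDim A ≤ d ↔ ∀ M : ModuleCat.{0} A, Module.Finite A M → PDimLE A (d + 1) M →
      PDimLE A d M := by
  constructor
  · intro h M _ hM
    rw [← projDim_le_iff] at hM ⊢
    have hne : projDim A M ≠ ⊤ := fun htop =>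
      ENat.natCast_ne_top _ (top_le_iff.mp (htop ▸ hM))
    have hle : projDim A M ≤ finDim A := le_sSup ⟨hne, M, inferInstance, rfl⟩
    exact hle.trans h
  · intro h
    refine sSup_le ?_
    rintro _ ⟨hne, M, hfin, rfl⟩
    obtain ⟨n, hn⟩ := ENat.ne_top_iff_exists.mp hne
    rw [projDim_le_iff]
    have hM : PDimLE A (n + d) M := ((projDim_le_iff M).mp hn.ge).mono (Nat.le_add_right n d)
    clear hn hne
    induction n with
    | zero => simpa using hM
    | succ n ih =>
      apply ih
      obtain ⟨N, _, hN⟩ := exists_isNthSyzygyOf M n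
      rw [hN.pDimLE_iff]
      refine h N inferInstance ?_
      rw [← hN.pDimLE_iff]
      exact hM.mono (by omega)

theorem pDimLE_of_indecomposable [IsArtinianRing A] {m n : ℕ}
    (h : ∀ M : ModuleCat.{0} A, Module.Finite A M → IndecomposableModule A M → PDimLE A m M →
      PDimLE A n M) (M : ModuleCat.{0} A) [Module.Finite A M] (hM : PDimLE A m M) :
    PDimLE A n M := by
  suffices key : ∀ N : Submodule A M, PDimLE A m N → PDimLE A n N from
    (key ⊤ (hM.of_equiv Submodule.topEquiv.symm)).of_equiv Submodule.topEquiv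
  intro N
  induction N using (wellFounded_lt (α := Submodule A M)).induction with
  | _ N ih =>
  intro hN
  by_cases hind : IndecomposableModule A (ModuleCat.of A N)
  · exact h (ModuleCat.of A N) (inferInstanceAs (Module.Finite A N)) hind hN
  · by_cases hnt : Nontrivial N
    · have hex : ∃ K K' : Submodule A N, IsCompl K K' ∧ K ≠ ⊥ ∧ K ≠ ⊤ := by
        by_contra hcon
        push Not at hcon
        exact hind ⟨hnt, fun K K' hK => or_iff_not_imp_left.mpr (hcon K K' hK)⟩
      obtain ⟨K, K', hc, hbot, htop⟩ := hex
      have hlt : ∀ L : Submodule A N, L ≠ ⊤ → L.map N.subtype < N := by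
        intro L hL
        refine lt_of_le_of_ne (Submodule.map_subtype_le N L) fun he => hL ?_
        apply Submodule.map_injective_of_injective N.injective_subtype
        rw [he, Submodule.map_top, Submodule.range_subtype]
      have htop' : K' ≠ ⊤ := by
        rintro rfl
        exact hbot (by simpa using hc.inf_eq_bot)
      have step : ∀ L : Submodule A N, L ≠ ⊤ → PDimLE A m L → PDimLE A n L := by
        intro L hL h'
        exact (ih _ (hlt L hL) (h'.of_equiv (Submodule.equivSubtypeMap N L))).of_equiv
          (Submodule.equivSubtypeMap N L).symm
      rw [← pDimLE_congr (Submodule.prodEquivOfIsCompl K K' hc), pDimLE_prod_iff] at hN ⊢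
      exact ⟨step K htop hN.1, step K' htop' hN.2⟩
    · rw [not_nontrivial_iff_subsingleton] at hnt
      have : PDimLE A 0 N := pDimLE_zero_iff.mpr inferInstance
      exact this.mono (Nat.zero_le n)

theorem finDim_le_iff_indecomposable [IsArtinianRing A] {d : ℕ} :
    finDim A ≤ d ↔ ∀ M : ModuleCat.{0} A, Module.Finite A M → IndecomposableModule A M →
      PDimLE A (d + 1) M → PDimLE A d M := by
  rw [finDim_le_iff]
  exact ⟨fun h M hM _ => h M hM, fun h M _ hM => pDimLE_of_indecomposable h M hM⟩

end ProjectiveDimension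

namespace CyclicQuiver

variable {A : Type} [Ring A] {V : Type} (Q : CyclicQuiver A V)

/-- The least length of a vanishing path starting at `v`, which is the length of `A * e v`. -/
def length (v : V) : ℕ := sInf {k | Q.path k v = 0}

/-- `M` is generated by an element `x = e v * x` with annihilator `A * (1 - e v) + A * path k v`,
where `p = (v, k)`. -/
def HasShape (M : Type) [AddCommGroup M] [Module A M] (p : V × ℕ) : Prop :=
  ∃ x : M, Q.idem p.1 • x = x ∧ (∀ y, ∃ a : A, a • x = y) ∧
    ∀ a : A, a • x = 0 ↔ ∃ z, a * Q.idem p.1 = z * Q.path p.2 p.1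

variable {Q}

theorem Nilpotent.length_le_iff (hQ : Q.Nilpotent) {v : V} {k : ℕ} :
    Q.length v ≤ k ↔ Q.path k v = 0 := by
  obtain ⟨N, hN⟩ := hQ
  have hmem : Q.path (Q.length v) v = 0 := Nat.sInf_mem (s := {k | Q.path k v = 0}) ⟨N, hN v⟩
  exact ⟨fun h => path_eq_zero_of_le h hmem, fun h => Nat.sInf_le h⟩

theorem Nilpotent.two_le_length (hQ : Q.Nilpotent) (v : V) : 2 ≤ Q.length v := by
  by_contra h
  have : Q.path 1 v = 0 := hQ.length_le_iff.mp (by omega)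
  exact Q.arrow_ne_zero v (by rwa [path_one] at this)

theorem Nilpotent.length_op (hQ : Q.Nilpotent) (v : V) (k : ℕ) :
    Q.length v ≤ k ↔ Q.op.length ((Q.next ^ k) v) ≤ k := by
  rw [hQ.length_le_iff, hQ.op.length_le_iff, op_path, MulOpposite.op_eq_zero_iff]

theorem Nilpotent.length_sub_le (hQ : Q.Nilpotent) (v : V) (k : ℕ) :
    Q.length v - k ≤ Q.length ((Q.next ^ k) v) := by
  rw [Nat.sub_le_iff_le_add, hQ.length_le_iff, path_add, hQ.length_le_iff.mp le_rfl, zero_mul]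

/-- Every element of `A * e v` generates the same left ideal as some path starting at `v`. -/
theorem Nilpotent.exists_path (hQ : Q.Nilpotent) {v : V} {x : A} (hx : x * Q.idem v = x) :
    ∃ (k : ℕ) (u z : A), x = u * Q.path k v ∧ z * x = Q.path k v := by
  have key : ∀ (n : ℕ) (v : V) (x : A), x * Q.idem v = x →
      (∃ (k : ℕ) (u z : A), x = u * Q.path k v ∧ z * x = Q.path k v) ∨
        ∃ u, x = u * Q.path n v := by
    intro n
    induction n with
    | zero => exact fun v x hx => Or.inr ⟨x, hx.symm⟩
    | succ n ih =>
      intro v x hx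
      rcases Q.left_generates v x hx with ⟨z, hz⟩ | ⟨z, hz⟩
      · exact Or.inl ⟨0, x, z, hx.symm, hz⟩
      · have hz' : x = z * Q.idem (Q.next v) * Q.arrow v := by
          rw [mul_assoc, Q.idem_mul_arrow, hz]
        rcases ih (Q.next v) (z * Q.idem (Q.next v)) (by rw [mul_assoc, Q.idem_mul_idem]) with
          ⟨k, u, y, hu, hy⟩ | ⟨u, hu⟩
        · refine Or.inl ⟨k + 1, u, y, ?_, ?_⟩
          · rw [path_succ, ← mul_assoc, ← hu, hz']
          · rw [path_succ, ← hy, mul_assoc, ← hz']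
        · exact Or.inr ⟨u, by rw [path_succ, ← mul_assoc, ← hu, hz']⟩
  obtain ⟨N, hN⟩ := hQ
  rcases key N v x hx with h | ⟨u, hu⟩
  · exact h
  · rw [hN, mul_zero] at hu
    exact ⟨N, 0, 0, by rw [hu, zero_mul], by rw [zero_mul, hN]⟩

theorem exists_path_eq_mul {k l : ℕ} {v : V} (h : k ≤ l) : ∃ z, Q.path l v = z * Q.path k v := by
  obtain ⟨m, rfl⟩ := Nat.exists_eq_add_of_le' h
  exact ⟨_, Q.path_add m k v⟩

theorem Nilpotent.mul_path_eq_zero_iff (hQ : Q.Nilpotent) {v : V} {k : ℕ} (hk : k ≤ Q.length v)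
    {x : A} (hx : x * Q.idem ((Q.next ^ k) v) = x) :
    x * Q.path k v = 0 ↔ ∃ z, x = z * Q.path (Q.length v - k) ((Q.next ^ k) v) := by
  constructor
  · intro h
    obtain ⟨j, u, y, hu, hy⟩ := hQ.exists_path hx
    have hj : Q.length v ≤ j + k := by
      rw [hQ.length_le_iff, path_add, ← hy, mul_assoc, h, mul_zero]
    obtain ⟨z, hz⟩ := exists_path_eq_mul (Q := Q) (v := (Q.next ^ k) v)
      (show Q.length v - k ≤ j by omega)
    exact ⟨u * z, by rw [mul_assoc, ← hz, hu]⟩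
  · rintro ⟨z, rfl⟩
    rw [mul_assoc, ← path_add, Nat.sub_add_cancel hk, hQ.length_le_iff.mp le_rfl, mul_zero]

variable {M : Type} [AddCommGroup M] [Module A M]

theorem HasShape.exists_cover (hQ : Q.Nilpotent) {p : V × ℕ} (hp : p.2 ≤ Q.length p.1)
    (h : Q.HasShape M p) : ∃ f : Submodule.span A {Q.idem p.1} →ₗ[A] M, Surjective f ∧
      Q.HasShape (LinearMap.ker f) (syzygyPair Q.next Q.length p) := by
  obtain ⟨v, k⟩ := p
  obtain ⟨x, hx, hgen, hann⟩ := h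
  have hmem : ∀ a : A, a ∈ Submodule.span A {Q.idem v} ↔ a * Q.idem v = a := by
    intro a
    rw [Submodule.mem_span_singleton]
    constructor
    · rintro ⟨b, rfl⟩
      rw [smul_eq_mul, mul_assoc, Q.idem_mul_idem]
    · exact fun h => ⟨a, h⟩
  let f := LinearMap.toSpanSingleton A M x ∘ₗ (Submodule.span A {Q.idem v}).subtype
  have hf : ∀ a, f a = (a : A) • x := fun a => rfl
  refine ⟨f, ?_, ?_⟩
  · intro y
    obtain ⟨a, rfl⟩ := hgen y
    exact ⟨⟨a * Q.idem v, (hmem _).mpr (by rw [mul_assoc, Q.idem_mul_idem])⟩, by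
      rw [hf, mul_smul, hx]⟩
  · let g : Submodule.span A {Q.idem v} := ⟨Q.path k v, (hmem _).mpr (Q.path_mul_idem k v)⟩
    have hg : g ∈ LinearMap.ker f := by
      rw [LinearMap.mem_ker, hf]
      exact (hann _).mpr ⟨1, by rw [one_mul]; exact Q.path_mul_idem k v⟩
    refine ⟨⟨g, hg⟩, ?_, ?_, ?_⟩
    · exact Subtype.ext (Subtype.ext (Q.idem_mul_path k v))
    · rintro ⟨⟨a, ha⟩, hfa⟩
      rw [LinearMap.mem_ker, hf] at hfa
      obtain ⟨z, hz⟩ := (hann a).mp hfa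
      refine ⟨z, Subtype.ext (Subtype.ext ?_)⟩
      rw [hmem] at ha
      exact hz.symm.trans ha
    · intro a
      have h₁ : a • (⟨g, hg⟩ : LinearMap.ker f) = 0 ↔ a * Q.path k v = 0 := by
        rw [Subtype.ext_iff, Subtype.ext_iff]
        rfl
      rw [h₁, ← Q.idem_mul_path k v, ← mul_assoc]
      exact hQ.mul_path_eq_zero_iff hp (by rw [mul_assoc, Q.idem_mul_idem])

theorem HasShape.projective_iff (hQ : Q.Nilpotent) {p : V × ℕ} (hp : p.2 ≤ Q.length p.1)
    (h : Q.HasShape M p) : Module.Projective A M ↔ IsProjectivePair Q.length p := by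
  constructor
  · intro hproj
    obtain ⟨v, k⟩ := p
    obtain ⟨x, hx, hgen, hann⟩ := h
    by_contra hcon
    obtain ⟨hk₀, hk⟩ := not_or.mp hcon
    obtain ⟨s, hs⟩ := Module.projective_lifting_property (LinearMap.toSpanSingleton A M x)
      LinearMap.id hgen
    have hs' : ∀ y, s y • x = y := fun y => LinearMap.congr_fun hs y
    set b := s x with hb
    have hsa : ∀ a : A, s (a • x) = a * b := fun a => by rw [map_smul, smul_eq_mul]
    have heb : Q.idem v * b = b := by rw [← hsa, hx]
    have hbb : b * b = b := by rw [← hsa, hs' x]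
    have hpb : Q.path k v * b = 0 := by
      rw [← hsa, (hann _).mpr ⟨1, by rw [one_mul]; exact Q.path_mul_idem k v⟩, map_zero]
    have hgg : b * Q.idem v * (b * Q.idem v) = b * Q.idem v := by
      rw [mul_assoc, ← mul_assoc (Q.idem v), heb, ← mul_assoc, hbb]
    have hge : b * Q.idem v * Q.idem v = b * Q.idem v := by rw [mul_assoc, Q.idem_mul_idem]
    rcases Q.left_generates v (b * Q.idem v) hge with ⟨z, hz⟩ | ⟨z, hz⟩
    · have hbe : Q.idem v = b * Q.idem v := by
        calc Q.idem v = z * (b * Q.idem v) := hz.symm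
          _ = z * (b * Q.idem v) * (b * Q.idem v) := by rw [mul_assoc z, hgg]
          _ = b * Q.idem v := by rw [hz, ← mul_assoc, heb]
      have : Q.path k v = 0 := by
        rw [← Q.path_mul_idem k v, hbe, ← mul_assoc, hpb, zero_mul]
      exact hk (le_antisymm hp (hQ.length_le_iff.mpr this))
    · obtain ⟨y, hy⟩ := (hann (Q.idem v - b)).mp (by rw [sub_smul, hx, hs' x, sub_self])
      obtain ⟨w, hw⟩ := exists_path_eq_mul (Q := Q) (v := v) (Nat.one_le_iff_ne_zero.mpr hk₀)
      apply Q.not_left_invertible v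
      refine ⟨z + y * w, ?_⟩
      dsimp only at hy
      rw [add_mul, ← hz, mul_assoc, ← path_one, ← hw, ← hy, sub_mul, Q.idem_mul_idem]
      abel
  · intro hpair
    have := projective_span_idem (Q.idem_mul_idem p.1)
    obtain ⟨v, k⟩ := p
    obtain ⟨x, hx, hgen, hann⟩ := h
    rcases hpair with hk | hk
    · have hx0 : x = 0 := by
        rw [← hx, hann]
        exact ⟨1, by dsimp only at hk ⊢; rw [hk, one_mul]; exact Q.idem_mul_idem v⟩
      have : Subsingleton M := subsingleton_of_forall_eq 0 fun y => by
        obtain ⟨a, rfl⟩ := hgen y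
        rw [hx0, smul_zero]
      infer_instance
    · let f := LinearMap.toSpanSingleton A M x ∘ₗ (Submodule.span A {Q.idem v}).subtype
      have hf : ∀ a, f a = (a : A) • x := fun a => rfl
      refine Module.Projective.of_equiv (LinearEquiv.ofBijective f ⟨?_, ?_⟩)
      · rw [← LinearMap.ker_eq_bot, LinearMap.ker_eq_bot']
        rintro ⟨a, ha⟩ hfa
        obtain ⟨b, hb⟩ := Submodule.mem_span_singleton.mp ha
        obtain ⟨z, hz⟩ := (hann a).mp hfa
        refine Subtype.ext ?_
        dsimp only at hz hk hb ⊢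
        rwa [hk, hQ.length_le_iff.mp le_rfl, mul_zero, ← hb, smul_eq_mul, mul_assoc,
          Q.idem_mul_idem, ← smul_eq_mul, hb] at hz
      · intro y
        obtain ⟨a, rfl⟩ := hgen y
        exact ⟨⟨a * Q.idem v, Submodule.mem_span_singleton.mpr ⟨a, rfl⟩⟩, by
          rw [hf, mul_smul, hx]⟩

theorem HasShape.pDimLE_iff (hQ : Q.Nilpotent) {n : ℕ} {p : V × ℕ} (hp : p.2 ≤ Q.length p.1)
    (h : Q.HasShape M p) :
    PDimLE A n M ↔ IsProjectivePair Q.length ((syzygyPair Q.next Q.length)^[n] p) := by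
  induction n generalizing M p with
  | zero => exact pDimLE_zero_iff.trans (h.projective_iff hQ hp)
  | succ n ih =>
    obtain ⟨f, hf, hker⟩ := h.exists_cover hQ hp
    have := projective_span_idem (Q.idem_mul_idem p.1)
    rw [pDimLE_succ_iff hf, ih (hQ.length_sub_le _ _) hker, Function.iterate_succ_apply]

theorem exists_hasShape (Q : CyclicQuiver A V) (p : V × ℕ) :
    ∃ M : ModuleCat.{0} A, Module.Finite A M ∧ Q.HasShape M p := by
  obtain ⟨v, k⟩ := p
  let I : Submodule A A := Submodule.span A {1 - Q.idem v, Q.path k v}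
  have hI : ∀ a : A, a ∈ I ↔ ∃ z, a * Q.idem v = z * Q.path k v := by
    intro a
    rw [Submodule.mem_span_pair]
    constructor
    · rintro ⟨b, z, rfl⟩
      refine ⟨z, ?_⟩
      rw [smul_eq_mul, smul_eq_mul, add_mul, mul_assoc, sub_mul, one_mul, Q.idem_mul_idem,
        sub_self, mul_zero, zero_add, mul_assoc, Q.path_mul_idem]
    · rintro ⟨z, hz⟩
      refine ⟨a, z, ?_⟩
      rw [smul_eq_mul, smul_eq_mul, ← hz, mul_sub, mul_one, sub_add_cancel]
  have hsmul : ∀ a : A, a • I.mkQ 1 = I.mkQ a := fun a => by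
    rw [← map_smul, smul_eq_mul, mul_one]
  refine ⟨ModuleCat.of A (A ⧸ I), inferInstanceAs (Module.Finite A (A ⧸ I)), I.mkQ 1, ?_, ?_, ?_⟩
  · refine (hsmul _).trans ?_
    rw [← sub_eq_zero, ← map_sub, Submodule.mkQ_apply, Submodule.Quotient.mk_eq_zero, hI]
    exact ⟨0, by rw [sub_mul, Q.idem_mul_idem, one_mul, sub_self, zero_mul]⟩
  · intro y
    obtain ⟨a, rfl⟩ := I.mkQ_surjective y
    exact ⟨a, hsmul a⟩
  · intro a
    rw [← hI, ← Submodule.Quotient.mk_eq_zero]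
    exact Eq.congr_left (hsmul a)

theorem Nilpotent.exists_shape (hQ : Q.Nilpotent) [Module.Finite A M] [Nontrivial M]
    (huni : ∀ N N' : Submodule A M, N ≤ N' ∨ N' ≤ N) :
    ∃ p : V × ℕ, p.2 ≤ Q.length p.1 ∧ Q.HasShape M p := by
  obtain ⟨N, hN, -⟩ := (eq_top_or_exists_le_coatom (⊥ : Submodule A M)).resolve_left bot_ne_top
  obtain ⟨y, -, hy⟩ := SetLike.exists_of_lt (lt_top_iff_ne_top.mpr hN.1)
  obtain ⟨v, b, hvb⟩ : ∃ v b, (Q.idem v * b) • y ∉ N := by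
    by_contra! hcon
    refine hy ?_
    have := Q.generatesUnit (N.toAddSubgroup.comap (LinearMap.toSpanSingleton A M y).toAddMonoidHom)
      (by
        rintro _ ⟨v, rfl⟩ a b
        have := N.smul_mem a (hcon v b)
        rwa [← mul_smul, ← mul_assoc] at this)
    rw [← one_smul A y]
    exact this
  set x := (Q.idem v * b) • y with hxdef
  have hx : Q.idem v • x = x := by rw [hxdef, ← mul_smul, ← mul_assoc, Q.idem_mul_idem]
  have hspan : Submodule.span A {x} = ⊤ := by
    have hxs := Submodule.mem_span_singleton_self (R := A) x
    refine hN.2 _ (lt_of_le_of_ne ?_ ?_)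
    · exact (huni _ _).resolve_right fun hle => hvb (hle hxs)
    · rintro rfl
      exact hvb hxs
  have hex : ∃ k, Q.path k v • x = 0 := by
    obtain ⟨n, hn⟩ := hQ
    exact ⟨n, by rw [hn, zero_smul]⟩
  refine ⟨(v, Nat.find hex), Nat.find_min' hex ?_, x, hx, ?_, fun a => ⟨fun ha => ?_, ?_⟩⟩
  · rw [hQ.length_le_iff.mp le_rfl, zero_smul]
  · intro z
    exact Submodule.mem_span_singleton.mp (hspan ▸ Submodule.mem_top)
  · obtain ⟨j, u, z, hu, hz⟩ := hQ.exists_path (v := v) (x := a * Q.idem v)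
      (by rw [mul_assoc, Q.idem_mul_idem])
    have hj : Nat.find hex ≤ j := Nat.find_min' hex (by
      rw [← hz, mul_smul, mul_smul, hx, ha, smul_zero])
    obtain ⟨w, hw⟩ := exists_path_eq_mul (Q := Q) (v := v) hj
    exact ⟨u * w, by rw [mul_assoc, ← hw]; exact hu⟩
  · rintro ⟨z, hz⟩
    dsimp only at hz
    rw [← hx, ← mul_smul, hz, mul_smul, Nat.find_spec hex, smul_zero]

theorem Nilpotent.finDim_le_iff (hQ : Q.Nilpotent) (hA : IsNakayamaRing A) {d : ℕ} :
    finDim A ≤ d ↔ PairDimLE Q.next Q.length d := by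
  have := hA.1
  constructor
  · intro h p hp
    obtain ⟨M, hfin, hM⟩ := Q.exists_hasShape p
    rw [← hM.pDimLE_iff hQ hp, ← hM.pDimLE_iff hQ hp]
    exact _root_.finDim_le_iff.mp h M hfin
  · rw [finDim_le_iff_indecomposable]
    intro h M _ hind
    have := hind.1
    obtain ⟨p, hp, hM⟩ := hQ.exists_shape (hA.2 M inferInstance hind)
    rw [hM.pDimLE_iff hQ hp, hM.pDimLE_iff hQ hp]
    exact h p hp

end CyclicQuiver

theorem ENat.eq_two_iff {n : ℕ∞} : n = 2 ↔ n ≤ (2 : ℕ) ∧ ¬ n ≤ (1 : ℕ) := by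
  cases n with
  | top => simp
  | coe n =>
    norm_cast
    omega

/-- For a cyclic Nakayama algebra `Λ`, `findim Λ = 2` iff
`findim Λᵒᵖ = 2`. -/
theorem findim_two_iff_findim_op_two
    (A : Type) [Ring A] (hA : IsCyclicNakayama A) :
    finDim A = 2 ↔ finDim Aᵐᵒᵖ = 2 := by
  obtain ⟨V, _, Q, hQ⟩ := hA.exists_cyclicQuiver
  obtain ⟨h₁, h₂⟩ := PairDimLE.inv_of_le_two (ν := Q.next) hQ.two_le_length hQ.op.two_le_length
    hQ.length_op
  rw [ENat.eq_two_iff, ENat.eq_two_iff, hQ.finDim_le_iff hA.1.1, hQ.finDim_le_iff hA.1.1,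
    hQ.op.finDim_le_iff hA.1.2, hQ.op.finDim_le_iff hA.1.2, h₁, h₂]
  rfl

end
end
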